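/- arXiv:1505.05664 — 3 statements merged into one kernel-verified Lean document; each statement's English description precedes it below -/
import Mathlib

section
/- Let φ(v) = v²/2 − log v on (0,∞) and, for c > 1/2, let T(c) = √2·∫_{c₁(c)}^{c₂(c)} dv/√(c − φ(v)), where c₁(c) ∈ (0,1) and c₂(c) ∈ (1,∞) are the two roots of φ(v) = c. Then the period function T : (1/2,∞) → ℝ is continuous and strictly decreasing. -/
open Real intervalIntegral

open Set Filter Topology MeasureTheory

/-! ### The reduced period integral of a `C²` function -/

/-- If `g` is `C²`, then `R ↦ ∫ g'(R sin θ) dθ` can be differentiated under the integral sign. -/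
lemma hasDerivAt_integral_deriv_comp_mul_sin {g : ℝ → ℝ} (hg : ContDiff ℝ 2 g) (R : ℝ) :
    HasDerivAt (fun R => ∫ θ in (-(π / 2))..(π / 2), deriv g (R * sin θ))
      (∫ θ in (-(π / 2))..(π / 2), deriv (deriv g) (R * sin θ) * sin θ) R := by
  have hg1 : ContDiff ℝ 1 (deriv g) := (contDiff_succ_iff_deriv (n := 1)).1 hg |>.2.2
  have hc1 : Continuous (deriv g) := hg1.continuous
  have hc2 : Continuous (deriv (deriv g)) := hg1.continuous_deriv le_rfl
  obtain ⟨C, hC⟩ := (isCompact_Icc (a := -(|R| + 1)) (b := |R| + 1)).exists_bound_of_continuousOn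
    hc2.continuousOn
  refine (intervalIntegral.hasDerivAt_integral_of_dominated_loc_of_deriv_le
    (F := fun R θ => deriv g (R * sin θ))
    (F' := fun R θ => deriv (deriv g) (R * sin θ) * sin θ) (bound := fun _ => C)
    (Metric.ball_mem_nhds R one_pos) (Eventually.of_forall fun x => ?_) ?_ ?_ ?_ ?_ ?_).2
  · exact (by fun_prop : Continuous fun θ => deriv g (x * sin θ)).aestronglyMeasurable
  · exact (by fun_prop : Continuous fun θ => deriv g (R * sin θ)).intervalIntegrable _ _
  · exact (by fun_prop : Continuous fun θ =>
      deriv (deriv g) (R * sin θ) * sin θ).aestronglyMeasurable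
  · refine Eventually.of_forall fun θ _ x hx => ?_
    have hxR : |x| ≤ |R| + 1 := by
      have h1 : |x - R| < 1 := by simpa [Real.dist_eq] using hx
      have h2 := abs_sub_abs_le_abs_sub x R
      linarith
    have hs : |sin θ| ≤ 1 := abs_sin_le_one θ
    have hxs : |x * sin θ| ≤ |R| + 1 := by
      rw [abs_mul]
      nlinarith [abs_nonneg x, abs_nonneg (sin θ)]
    have h3 := hC (x * sin θ) (abs_le.1 hxs)
    rw [norm_mul, Real.norm_eq_abs (sin θ)]
    nlinarith [norm_nonneg (deriv (deriv g) (x * sin θ)), abs_nonneg (sin θ)]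
  · exact intervalIntegrable_const
  · refine Eventually.of_forall fun θ _ x _ => ?_
    have h1 : HasDerivAt (deriv g) (deriv (deriv g) (x * sin θ)) (x * sin θ) :=
      (hg1.differentiable one_ne_zero _).hasDerivAt
    have h2 : HasDerivAt (fun x : ℝ => x * sin θ) (sin θ) x := by
      simpa using (hasDerivAt_id x).mul_const (sin θ)
    exact h1.comp x h2

/-- Integration by parts replaces `s² g''` by `s² g'' + s g' - g` in the derivative of
`R ↦ ∫ g'(R sin θ) dθ`. -/
lemma sq_mul_integral_deriv_deriv_mul_sin {g : ℝ → ℝ} (hg : ContDiff ℝ 2 g) (R : ℝ) :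
    R ^ 2 * ∫ θ in (-(π / 2))..(π / 2), deriv (deriv g) (R * sin θ) * sin θ =
      ∫ θ in (-(π / 2))..(π / 2), (R * sin θ * deriv g (R * sin θ) +
        (R * sin θ) ^ 2 * deriv (deriv g) (R * sin θ) - g (R * sin θ)) * sin θ := by
  have hg1 : ContDiff ℝ 1 (deriv g) := (contDiff_succ_iff_deriv (n := 1)).1 hg |>.2.2
  have hc0 : Continuous g := hg.continuous
  have hc1 : Continuous (deriv g) := hg1.continuous
  have hc2 : Continuous (deriv (deriv g)) := hg1.continuous_deriv le_rfl
  have key : ∫ θ in (-(π / 2))..(π / 2),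
      (R ^ 2 * (deriv (deriv g) (R * sin θ) * sin θ) -
        (R * sin θ * deriv g (R * sin θ) +
        (R * sin θ) ^ 2 * deriv (deriv g) (R * sin θ) - g (R * sin θ)) * sin θ) = 0 := by
    rw [intervalIntegral.integral_eq_sub_of_hasDerivAt
      (f := fun θ => R * deriv g (R * sin θ) * (sin θ * cos θ) - g (R * sin θ) * cos θ)]
    · simp
    · intro θ _
      have hs : HasDerivAt (fun θ => R * sin θ) (R * cos θ) θ :=
        (hasDerivAt_sin θ).const_mul R
      have h0 : HasDerivAt (fun θ => g (R * sin θ)) (deriv g (R * sin θ) * (R * cos θ)) θ :=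
        (hg.differentiable two_ne_zero _).hasDerivAt.comp θ hs
      have h1 : HasDerivAt (fun θ => deriv g (R * sin θ))
          (deriv (deriv g) (R * sin θ) * (R * cos θ)) θ :=
        (hg1.differentiable one_ne_zero _).hasDerivAt.comp θ hs
      convert! ((h1.const_mul R).mul ((hasDerivAt_sin θ).mul (hasDerivAt_cos θ))).sub
        (h0.mul (hasDerivAt_cos θ)) using 1
      have hcos : cos θ ^ 2 = 1 - sin θ ^ 2 := by
        rw [← sin_sq_add_cos_sq θ]; ring
      simp only [Pi.mul_apply]
      linear_combination (-(R ^ 2 * deriv (deriv g) (R * sin θ) * sin θ)) * hcos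
    · exact Continuous.intervalIntegrable (by fun_prop) _ _
  rw [intervalIntegral.integral_sub (Continuous.intervalIntegrable (by fun_prop) _ _)
    (Continuous.intervalIntegrable (by fun_prop) _ _), intervalIntegral.integral_const_mul] at key
  linarith

/-- If `q(s) = s g' + s² g'' - g` satisfies `q(s) < q(-s)` for `s > 0`, then
`R ↦ ∫ g'(R sin θ) dθ` is strictly decreasing for `R > 0`. -/
lemma strictAntiOn_integral_deriv_comp_mul_sin {g : ℝ → ℝ} (hg : ContDiff ℝ 2 g)
    (hq : ∀ s, 0 < s → s * deriv g s + s ^ 2 * deriv (deriv g) s - g s <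
      -s * deriv g (-s) + (-s) ^ 2 * deriv (deriv g) (-s) - g (-s)) :
    StrictAntiOn (fun R => ∫ θ in (-(π / 2))..(π / 2), deriv g (R * sin θ)) (Ioi 0) := by
  have hg1 : ContDiff ℝ 1 (deriv g) := (contDiff_succ_iff_deriv (n := 1)).1 hg |>.2.2
  have hc0 : Continuous g := hg.continuous
  have hc1 : Continuous (deriv g) := hg1.continuous
  have hc2 : Continuous (deriv (deriv g)) := hg1.continuous_deriv le_rfl
  refine strictAntiOn_of_deriv_neg (convex_Ioi 0)
    (fun R _ => (hasDerivAt_integral_deriv_comp_mul_sin hg R).continuousAt.continuousWithinAt)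
    fun R hR => ?_
  rw [interior_Ioi, mem_Ioi] at hR
  rw [(hasDerivAt_integral_deriv_comp_mul_sin hg R).deriv]
  refine neg_of_mul_neg_right (a := R ^ 2) ?_ (by positivity)
  rw [sq_mul_integral_deriv_deriv_mul_sin hg R]
  set q : ℝ → ℝ := fun s => s * deriv g s + s ^ 2 * deriv (deriv g) s - g s with hq_def
  have hqc : Continuous q := by fun_prop
  change ∫ θ in (-(π / 2))..(π / 2), q (R * sin θ) * sin θ < 0
  have hint : ∀ a b, IntervalIntegrable (fun θ => q (R * sin θ) * sin θ) volume a b :=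
    fun a b => Continuous.intervalIntegrable (by fun_prop) a b
  have hint' : ∀ a b, IntervalIntegrable (fun θ => q (-(R * sin θ)) * sin θ) volume a b :=
    fun a b => Continuous.intervalIntegrable (by fun_prop) a b
  have hneg : ∫ θ in (-(π / 2))..0, q (R * sin θ) * sin θ =
      -∫ θ in (0 : ℝ)..(π / 2), q (-(R * sin θ)) * sin θ := by
    have := intervalIntegral.integral_comp_neg (a := 0) (b := π / 2)
      (fun θ => q (R * sin θ) * sin θ)
    rw [neg_zero] at this
    rw [← this, ← intervalIntegral.integral_neg]
    simp
  rw [← intervalIntegral.integral_add_adjacent_intervals (hint _ 0) (hint 0 _), hneg]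
  have hpos : 0 < ∫ θ in (0 : ℝ)..(π / 2),
      (q (-(R * sin θ)) * sin θ - q (R * sin θ) * sin θ) := by
    refine intervalIntegral.intervalIntegral_pos_of_pos_on ((hint' _ _).sub (hint _ _)) ?_
      (by positivity)
    intro θ hθ
    have hs : 0 < sin θ := sin_pos_of_pos_of_lt_pi hθ.1 (by linarith [hθ.2, pi_pos])
    have h1 : q (R * sin θ) < q (-(R * sin θ)) := hq _ (mul_pos hR hs)
    nlinarith
  rw [intervalIntegral.integral_sub (hint' _ _) (hint _ _)] at hpos
  linarith

/-- The substitution `v = g (R sin θ)` turns a period integral into a regular one. -/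
lemma integral_one_div_sqrt_eq {g V : ℝ → ℝ} (hg : ContDiff ℝ 1 g) (hmono : StrictMono g)
    (hV : ∀ s, V (g s) = s ^ 2) {R : ℝ} (hR : 0 < R) :
    ∫ v in (g (-R))..(g R), 1 / √(R ^ 2 - V v) =
      ∫ θ in (-(π / 2))..(π / 2), deriv g (R * sin θ) := by
  have hpi : -(π / 2) ≤ π / 2 := by linarith [pi_pos]
  have hle : g (-R) ≤ g R := hmono.monotone (by linarith)
  set f : ℝ → ℝ := fun θ => g (R * sin θ) with hf_def
  have hfc : Continuous f := by have := hg.continuous; fun_prop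
  have hfmono : StrictMonoOn f (Icc (-(π / 2)) (π / 2)) := fun x hx y hy hxy =>
    hmono (mul_lt_mul_of_pos_left (strictMonoOn_sin hx hy hxy) hR)
  have himg : f '' Ioo (-(π / 2)) (π / 2) = Ioo (g (-R)) (g R) := by
    have := hfc.continuousOn.image_Ioo_of_strictMonoOn hpi hfmono
    simpa [hf_def] using this
  rw [intervalIntegral.integral_of_le hle, integral_Ioc_eq_integral_Ioo, ← himg,
    integral_image_eq_integral_abs_deriv_smul (f := f)
      (f' := fun θ => deriv g (R * sin θ) * (R * cos θ)) measurableSet_Ioo ?_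
      (hfmono.injOn.mono Ioo_subset_Icc_self),
    intervalIntegral.integral_of_le hpi, integral_Ioc_eq_integral_Ioo]
  · refine setIntegral_congr_fun measurableSet_Ioo fun θ hθ => ?_
    have hcos : 0 < cos θ := cos_pos_of_mem_Ioo hθ
    have hsq : R ^ 2 - V (f θ) = (R * cos θ) ^ 2 := by
      rw [hf_def, hV, mul_pow, mul_pow, cos_sq']; ring
    have hd : 0 ≤ deriv g (R * sin θ) := hmono.monotone.deriv_nonneg
    have hp : 0 < R * cos θ := mul_pos hR hcos
    simp only [smul_eq_mul]
    rw [hsq, sqrt_sq hp.le, abs_of_nonneg (mul_nonneg hd hp.le)]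
    field_simp
  · intro θ _
    exact (((hg.differentiable one_ne_zero _).hasDerivAt).comp θ
      ((hasDerivAt_sin θ).const_mul R)).hasDerivWithinAt

/-! ### A square root of the normalized potential -/

/-- The potential `v²/2 - log v`, normalized to vanish at its minimum `v = 1`. -/
noncomputable def normalizedPotential (v : ℝ) : ℝ := v ^ 2 / 2 - log v - 1 / 2

/-- The analytic function `normalizedPotential v / (v - 1)²`. -/
noncomputable def potentialQuotient (v : ℝ) : ℝ :=
  dslope (dslope normalizedPotential 1) 1 v

/-- The signed square root of `normalizedPotential`. -/
noncomputable def potentialRoot (v : ℝ) : ℝ := (v - 1) * √(potentialQuotient v)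

lemma hasDerivAt_normalizedPotential {v : ℝ} (hv : 0 < v) :
    HasDerivAt normalizedPotential (v - v⁻¹) v := by
  have := (((hasDerivAt_pow 2 v).div_const 2).sub (hasDerivAt_log hv.ne')).sub_const (1 / 2)
  convert! this using 1
  simp

lemma analyticAt_normalizedPotential {v : ℝ} (hv : 0 < v) :
    AnalyticAt ℝ normalizedPotential v := by
  unfold normalizedPotential
  have := analyticAt_log hv
  fun_prop

lemma sq_sub_one_mul_potentialQuotient (v : ℝ) :
    (v - 1) ^ 2 * potentialQuotient v = normalizedPotential v := by
  have h0 : normalizedPotential 1 = 0 := by simp [normalizedPotential]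
  have h1 : dslope normalizedPotential 1 1 = 0 := by
    rw [dslope_same, (hasDerivAt_normalizedPotential one_pos).deriv]; simp
  have e1 := sub_smul_dslope normalizedPotential 1 v
  have e2 := sub_smul_dslope (dslope normalizedPotential 1) 1 v
  simp only [smul_eq_mul, h0, h1, sub_zero] at e1 e2
  rw [← e1, ← e2, potentialQuotient]
  ring

lemma AnalyticAt.dslope_self {f : ℝ → ℝ} {a : ℝ} (hf : AnalyticAt ℝ f a) :
    AnalyticAt ℝ (dslope f a) a := by
  obtain ⟨p, hp⟩ := hf
  exact ⟨_, hp.has_fpower_series_dslope_fslope⟩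

lemma analyticAt_potentialQuotient {v : ℝ} (hv : 0 < v) :
    AnalyticAt ℝ potentialQuotient v := by
  rcases eq_or_ne v 1 with rfl | h1
  · exact (analyticAt_normalizedPotential one_pos).dslope_self.dslope_self
  · have ha : AnalyticAt ℝ (fun x => normalizedPotential x / (x - 1) ^ 2) v :=
      (analyticAt_normalizedPotential hv).div (by fun_prop) (pow_ne_zero _ (sub_ne_zero.2 h1))
    refine ha.congr ?_
    filter_upwards [isOpen_ne.mem_nhds h1] with x hx
    rw [← sq_sub_one_mul_potentialQuotient, mul_div_cancel_left₀]
    exact pow_ne_zero _ (sub_ne_zero.2 hx)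

lemma sq_div_two_le_normalizedPotential {v : ℝ} (hv : 0 < v) :
    (v - 1) ^ 2 / 2 ≤ normalizedPotential v := by
  have := log_le_sub_one_of_pos hv
  unfold normalizedPotential
  linarith

lemma potentialQuotient_pos {v : ℝ} (hv : 0 < v) : 0 < potentialQuotient v := by
  have hne : ∀ x : ℝ, 0 < x → x ≠ 1 → 1 / 2 ≤ potentialQuotient x := fun x hx h1 => by
    have h2 := sq_div_two_le_normalizedPotential hx
    rw [← sq_sub_one_mul_potentialQuotient] at h2
    have h3 : 0 < (x - 1) ^ 2 := by have := sub_ne_zero.2 h1; positivity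
    nlinarith
  rcases eq_or_ne v 1 with rfl | h1
  · have hc := (analyticAt_potentialQuotient one_pos).continuousAt.tendsto.mono_left
      (nhdsWithin_le_nhds (s := Ioi 1))
    have h2 := ge_of_tendsto hc (b := 1 / 2) (by
      filter_upwards [self_mem_nhdsWithin] with x hx
      exact hne x (one_pos.trans hx) (ne_of_gt hx))
    linarith
  · linarith [hne v hv h1]

lemma potentialRoot_sq {v : ℝ} (hv : 0 < v) : potentialRoot v ^ 2 = normalizedPotential v := by
  rw [potentialRoot, mul_pow, sq_sqrt (potentialQuotient_pos hv).le,
    sq_sub_one_mul_potentialQuotient]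

lemma contDiffAt_potentialRoot {v : ℝ} (hv : 0 < v) : ContDiffAt ℝ 2 potentialRoot v :=
  (contDiffAt_id.sub contDiffAt_const).mul
    ((analyticAt_potentialQuotient hv).contDiffAt.sqrt (potentialQuotient_pos hv).ne')

lemma deriv_potentialRoot_pos {v : ℝ} (hv : 0 < v) : 0 < deriv potentialRoot v := by
  have hd : HasDerivAt potentialRoot (deriv potentialRoot v) v :=
    ((contDiffAt_potentialRoot hv).differentiableAt two_ne_zero).hasDerivAt
  have hsqrt := sqrt_pos.2 (potentialQuotient_pos hv)
  rcases eq_or_ne v 1 with rfl | h1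
  · have hk : DifferentiableAt ℝ (fun x => √(potentialQuotient x)) 1 :=
      (analyticAt_potentialQuotient one_pos).differentiableAt.sqrt (potentialQuotient_pos hv).ne'
    have := ((hasDerivAt_id (1 : ℝ)).sub_const 1).mul hk.hasDerivAt
    rw [show deriv potentialRoot 1 = _ from this.deriv]
    simpa using hsqrt
  · have hsq : HasDerivAt normalizedPotential (2 * potentialRoot v * deriv potentialRoot v) v := by
      have := hd.pow 2
      refine (this.congr_of_eventuallyEq ?_).congr_deriv (by simp)
      filter_upwards [lt_mem_nhds hv] with x hx
      exact (potentialRoot_sq hx).symm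
    have he := hsq.unique (hasDerivAt_normalizedPotential hv)
    have he' : 2 * √(potentialQuotient v) * deriv potentialRoot v * v = v + 1 := by
      have : (v - 1) * (2 * √(potentialQuotient v) * deriv potentialRoot v * v) =
          (v - 1) * (v + 1) := by
        rw [potentialRoot] at he
        field_simp at he
        linarith
      exact mul_left_cancel₀ (sub_ne_zero.2 h1) this
    by_contra! hcon
    have := mul_nonneg_of_nonpos_of_nonpos hcon (show -(2 * √(potentialQuotient v) * v) ≤ 0 by
      have := mul_pos hsqrt hv; linarith)
    nlinarith

lemma strictMonoOn_potentialRoot : StrictMonoOn potentialRoot (Ioi 0) :=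
  strictMonoOn_of_deriv_pos (convex_Ioi 0)
    (fun _ hv => (contDiffAt_potentialRoot hv).continuousAt.continuousWithinAt)
    fun _ hv => deriv_potentialRoot_pos (by simpa using hv)

lemma potentialRoot_of_one_lt {v s : ℝ} (hv : 1 < v) (hs : 0 ≤ s)
    (h : normalizedPotential v = s ^ 2) : potentialRoot v = s := by
  have h0 : 0 ≤ potentialRoot v := mul_nonneg (by linarith) (sqrt_nonneg _)
  rw [← potentialRoot_sq (one_pos.trans hv)] at h
  exact (pow_left_inj₀ h0 hs two_ne_zero).1 h

lemma potentialRoot_of_lt_one {v s : ℝ} (hv : 0 < v) (hv1 : v < 1) (hs : 0 ≤ s)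
    (h : normalizedPotential v = s ^ 2) : potentialRoot v = -s := by
  have h0 : 0 ≤ -potentialRoot v := by
    rw [potentialRoot, ← neg_mul]
    exact mul_nonneg (by linarith) (sqrt_nonneg _)
  rw [← potentialRoot_sq hv, ← neg_sq] at h
  linarith [(pow_left_inj₀ h0 hs two_ne_zero).1 h]

lemma contDiff_of_potentialRoot_comp {g : ℝ → ℝ} (hpos : ∀ s, 0 < g s)
    (hroot : ∀ s, potentialRoot (g s) = s) : ContDiff ℝ 2 g := by
  rw [contDiff_iff_contDiffAt]
  intro s
  have hc := contDiffAt_potentialRoot (hpos s)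
  have hd : HasDerivAt potentialRoot (deriv potentialRoot (g s)) (g s) :=
    (hc.differentiableAt two_ne_zero).hasDerivAt
  have hd' := hd.hasFDerivAt_equiv (deriv_potentialRoot_pos (hpos s)).ne'
  have hloc := hc.to_localInverse hd' two_ne_zero
  rw [hroot] at hloc
  refine hloc.congr_of_eventuallyEq ?_
  have hleft : ∀ᶠ v in 𝓝 (g s), g (potentialRoot v) = v := by
    filter_upwards [lt_mem_nhds (hpos s)] with v hv
    exact strictMonoOn_potentialRoot.injOn (hpos _) hv (hroot _)
  have := (hc.hasStrictFDerivAt' hd' two_ne_zero).localInverse_unique hleft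
  rw [hroot] at this
  exact this

/-! ### The pointwise comparison -/

/-- For the inverse `g` of the signed square root of `normalizedPotential`, this is
`s g' + s² g'' - g` as a function of `v = g s` and `E = s²`. -/
noncomputable def periodDensity (v E : ℝ) : ℝ :=
  4 * v * E / (v ^ 2 - 1) - 4 * v * (v ^ 2 + 1) * E ^ 2 / (v ^ 2 - 1) ^ 3 - v

lemma eq_periodDensity {g : ℝ → ℝ} (hg : ContDiff ℝ 2 g) (hpos : ∀ s, 0 < g s)
    (hV : ∀ s, normalizedPotential (g s) = s ^ 2) {s : ℝ} (h1 : g s ^ 2 - 1 ≠ 0) :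
    s * deriv g s + s ^ 2 * deriv (deriv g) s - g s = periodDensity (g s) (s ^ 2) := by
  have hg1 : ContDiff ℝ 1 (deriv g) := (contDiff_succ_iff_deriv (n := 1)).1 hg |>.2.2
  have hd (t : ℝ) : HasDerivAt g (deriv g t) t := (hg.differentiable two_ne_zero t).hasDerivAt
  have hd2 : HasDerivAt (deriv g) (deriv (deriv g) s) s :=
    (hg1.differentiable one_ne_zero s).hasDerivAt
  have e1 (t : ℝ) : (g t ^ 2 - 1) * deriv g t = 2 * t * g t := by
    have ha := (hasDerivAt_normalizedPotential (hpos t)).comp t (hd t)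
    have hb : HasDerivAt (normalizedPotential ∘ g) (2 * t) t := by
      rw [show normalizedPotential ∘ g = fun s => s ^ 2 from funext hV]
      simpa using hasDerivAt_pow 2 t
    have := ha.unique hb
    have hne := (hpos t).ne'
    field_simp at this
    linarith
  have e2 : 2 * g s * deriv g s ^ 2 + (g s ^ 2 - 1) * deriv (deriv g) s =
      2 * g s + 2 * s * deriv g s := by
    have ha := (((hd s).pow 2).sub_const 1).mul hd2
    have hb := ((hasDerivAt_id s).const_mul 2).mul (hd s)
    have hab := ha.unique (hb.congr_of_eventuallyEq (Eventually.of_forall fun t => by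
      simpa using e1 t))
    simp at hab
    linarith
  have e1' : deriv g s = 2 * s * g s / (g s ^ 2 - 1) := by
    rw [eq_div_iff h1]; linarith [e1 s]
  have e2' : deriv (deriv g) s =
      (2 * g s + 2 * s * deriv g s - 2 * g s * deriv g s ^ 2) / (g s ^ 2 - 1) := by
    rw [eq_div_iff h1]; linarith
  rw [e2', e1', periodDensity]
  field_simp
  ring

lemma periodDensity_neg {v : ℝ} (hv : 1 < v) (E : ℝ) : periodDensity v E < 0 := by
  have hd : 0 < v ^ 2 - 1 := by nlinarith
  have key : periodDensity v E =
      -(v * ((v ^ 2 - 1) * (2 * (E / (v ^ 2 - 1)) - 1) ^ 2 + 8 * (E / (v ^ 2 - 1)) ^ 2)) /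
        (v ^ 2 - 1) := by
    rw [periodDensity]; field_simp; ring
  rw [key]
  refine div_neg_of_neg_of_pos (neg_neg_of_pos (mul_pos (by linarith) ?_)) hd
  rcases eq_or_ne E 0 with rfl | hE
  · simpa using hd
  · positivity

lemma periodDensity_pos {v E : ℝ} (hv : 0 < v) (hv1 : v < 1) (hE : 2 ≤ E) :
    0 < periodDensity v E := by
  have hd : 0 < 1 - v ^ 2 := by nlinarith
  have hd' : v ^ 2 - 1 ≠ 0 := by linarith
  set w := E / (1 - v ^ 2) with hw_def
  have hw : 2 ≤ w := by
    rw [hw_def, le_div_iff₀ hd]; nlinarith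
  have hEw : E = w * (1 - v ^ 2) := by rw [hw_def]; field_simp
  have key : periodDensity v E =
      v * ((1 - v ^ 2) * (4 * w ^ 2 - 4 * w - 1) + 8 * v ^ 2 * w ^ 2) / (1 - v ^ 2) := by
    have h3 : (v ^ 2 - 1) ^ 3 = -(1 - v ^ 2) ^ 3 := by ring
    have h4 : v ^ 2 - 1 = -(1 - v ^ 2) := by ring
    rw [periodDensity, hEw, h3, h4]; field_simp; ring
  rw [key]
  have : 0 < 4 * w ^ 2 - 4 * w - 1 := by nlinarith
  positivity

lemma periodDensity_sub_eq {v : ℝ} (hv : v ≠ 0) (hd : v ^ 2 - 1 ≠ 0) (E : ℝ) :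
    periodDensity v E - (E / 2 - 1) =
      -(((8 * v * (v ^ 2 + 1) * (E / (v ^ 2 - 1)) +
            ((v ^ 2 - 1) ^ 2 / 2 - 4 * v * (v ^ 2 - 1))) ^ 2 +
          (v - 1) ^ 4 * (v + 1) * (4 * v * (v + 3) - (v + 1) ^ 3 / 4)) /
        (16 * v * (v ^ 2 + 1))) / (v ^ 2 - 1) := by
  rw [periodDensity]
  field_simp
  ring

lemma periodDensity_numerator_pos {v : ℝ} (hv : 1 / 30 < v) (hv3 : v < 3) (hv1 : v ≠ 1) (x : ℝ) :
    0 < (x ^ 2 + (v - 1) ^ 4 * (v + 1) * (4 * v * (v + 3) - (v + 1) ^ 3 / 4)) /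
      (16 * v * (v ^ 2 + 1)) := by
  have hv0 : 0 < v := by linarith
  have h1 : 0 < 4 * v * (v + 3) - (v + 1) ^ 3 / 4 := by
    nlinarith [mul_nonneg (sq_nonneg v) (show 0 ≤ 13 - v by linarith)]
  have h2 := sub_ne_zero.2 hv1
  positivity

lemma periodDensity_lt_periodDensity {a b E : ℝ} (ha : 0 < a) (ha1 : a < 1) (hb : 1 < b)
    (hEa : normalizedPotential a = E) (hEb : normalizedPotential b = E) :
    periodDensity b E < periodDensity a E := by
  rcases le_or_gt 2 E with hE | hE
  · exact (periodDensity_neg hb E).trans (periodDensity_pos ha ha1 hE)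
  have hb3 : b < 3 := by
    have := sq_div_two_le_normalizedPotential (one_pos.trans hb)
    nlinarith
  have ha3 : 1 / 30 < a := by
    have h1 : -3 < log a := by
      rw [normalizedPotential] at hEa
      nlinarith [sq_nonneg a]
    have h2 : exp 3 < 30 := by
      rw [show (3 : ℝ) = (3 : ℕ) * 1 by norm_num, exp_nat_mul]
      calc exp 1 ^ 3 < 3 ^ 3 := by
            gcongr
            linarith [exp_one_lt_d9]
        _ < 30 := by norm_num
    have h3 := (lt_log_iff_exp_lt ha).1 h1
    rw [exp_neg] at h3
    refine lt_trans ?_ h3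
    rw [one_div]
    exact inv_strictAnti₀ (exp_pos 3) h2
  have hda : a ^ 2 - 1 < 0 := by nlinarith
  have hdb : 0 < b ^ 2 - 1 := by nlinarith
  have ka : 0 < periodDensity a E - (E / 2 - 1) := by
    rw [periodDensity_sub_eq ha.ne' hda.ne]
    exact div_pos_of_neg_of_neg (neg_neg_of_pos
      (periodDensity_numerator_pos ha3 (by linarith) ha1.ne _)) hda
  have kb : periodDensity b E - (E / 2 - 1) < 0 := by
    rw [periodDensity_sub_eq (by linarith) hdb.ne']
    exact div_neg_of_neg_of_pos (neg_neg_of_pos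
      (periodDensity_numerator_pos (by linarith) hb3 hb.ne' _)) hdb
  linarith

/-- with `φ(v) = v²/2 − log v` and, for `c > 1/2`,
`c₁(c) ∈ (0,1)`, `c₂(c) ∈ (1,∞)` the two roots of `φ(v) = c`, the period
function `T(c) = √2·∫_{c₁(c)}^{c₂(c)} dv/√(c − φ(v))` is continuous and
strictly decreasing on `(1/2,∞)`. -/
theorem stmt_12 (c₁ c₂ : ℝ → ℝ)
    (h : ∀ c ∈ Set.Ioi (1/2 : ℝ),
      c₁ c ∈ Set.Ioo (0:ℝ) 1 ∧ c₂ c ∈ Set.Ioi (1:ℝ) ∧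
      (c₁ c) ^ 2 / 2 - Real.log (c₁ c) = c ∧ (c₂ c) ^ 2 / 2 - Real.log (c₂ c) = c) :
    ContinuousOn
      (fun c : ℝ =>
        Real.sqrt 2 * ∫ v in (c₁ c)..(c₂ c), 1 / Real.sqrt (c - (v ^ 2 / 2 - Real.log v)))
      (Set.Ioi (1/2 : ℝ)) ∧
    StrictAntiOn
      (fun c : ℝ =>
        Real.sqrt 2 * ∫ v in (c₁ c)..(c₂ c), 1 / Real.sqrt (c - (v ^ 2 / 2 - Real.log v)))
      (Set.Ioi (1/2 : ℝ)) := by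
  -- `g` is the inverse of the signed square root of the normalized potential.
  set g : ℝ → ℝ := fun s =>
    if s = 0 then 1 else if 0 < s then c₂ (1 / 2 + s ^ 2) else c₁ (1 / 2 + s ^ 2) with hg_def
  have hc₁ (c : ℝ) (hc : 1 / 2 < c) : potentialRoot (c₁ c) = -√(c - 1 / 2) := by
    obtain ⟨h1, -, h3, -⟩ := h c hc
    refine potentialRoot_of_lt_one h1.1 h1.2 (sqrt_nonneg _) ?_
    rw [sq_sqrt (by linarith), normalizedPotential]; linarith
  have hc₂ (c : ℝ) (hc : 1 / 2 < c) : potentialRoot (c₂ c) = √(c - 1 / 2) := by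
    obtain ⟨-, h2, -, h4⟩ := h c hc
    refine potentialRoot_of_one_lt h2 (sqrt_nonneg _) ?_
    rw [sq_sqrt (by linarith), normalizedPotential]; linarith
  have hmem (s : ℝ) (hs : s ≠ 0) : 1 / 2 < 1 / 2 + s ^ 2 := by
    have : 0 < s ^ 2 := by positivity
    linarith
  have hpos (s : ℝ) : 0 < g s := by
    rw [hg_def]
    dsimp only
    split_ifs with h0 h1
    · exact one_pos
    · exact one_pos.trans (h _ (hmem s h0)).2.1
    · exact (h _ (hmem s h0)).1.1
  have hroot (s : ℝ) : potentialRoot (g s) = s := by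
    rw [hg_def]
    dsimp only
    split_ifs with h0 h1
    · simp [potentialRoot, h0]
    · rw [hc₂ _ (hmem s h0), add_sub_cancel_left, sqrt_sq h1.le]
    · rw [hc₁ _ (hmem s h0), add_sub_cancel_left, sqrt_sq_eq_abs, abs_of_nonpos (not_lt.1 h1),
        neg_neg]
  have hg : ContDiff ℝ 2 g := contDiff_of_potentialRoot_comp hpos hroot
  have hV (s : ℝ) : normalizedPotential (g s) = s ^ 2 := by
    rw [← potentialRoot_sq (hpos s), hroot]
  have hmono : StrictMono g := fun s t hst => by
    rwa [← strictMonoOn_potentialRoot.lt_iff_lt (hpos s) (hpos t), hroot, hroot]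
  have hgone : g 0 = 1 := by simp [hg_def]
  have hanti := strictAntiOn_integral_deriv_comp_mul_sin hg fun s hs => by
    have hb : 1 < g s := hgone ▸ hmono hs
    have ha : g (-s) < 1 := hgone ▸ hmono (neg_lt_zero.2 hs)
    have ha0 := hpos (-s)
    rw [eq_periodDensity hg hpos hV (s := s) (by nlinarith),
      eq_periodDensity hg hpos hV (s := -s) (by nlinarith), neg_sq]
    exact periodDensity_lt_periodDensity ha0 ha hb (by rw [hV, neg_sq]) (hV s)
  have hT : EqOn (fun c : ℝ =>
        √2 * ∫ v in (c₁ c)..(c₂ c), 1 / √(c - (v ^ 2 / 2 - log v)))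
      (fun c => √2 * ∫ θ in (-(π / 2))..(π / 2), deriv g (√(c - 1 / 2) * sin θ))
      (Ioi (1 / 2 : ℝ)) := fun c hc => by
    have hc' : 0 < c - 1 / 2 := sub_pos.2 hc
    have e1 : g (-√(c - 1 / 2)) = c₁ c :=
      strictMonoOn_potentialRoot.injOn (hpos _) (h c hc).1.1 (by rw [hroot, hc₁ c hc])
    have e2 : g (√(c - 1 / 2)) = c₂ c :=
      strictMonoOn_potentialRoot.injOn (hpos _) (mem_Ioi.2 (one_pos.trans (h c hc).2.1))
        (by rw [hroot, hc₂ c hc])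
    have := integral_one_div_sqrt_eq (hg.of_le one_le_two) hmono hV (sqrt_pos.2 hc')
    rw [e1, e2, sq_sqrt hc'.le] at this
    have hsub (v : ℝ) : c - 1 / 2 - normalizedPotential v = c - (v ^ 2 / 2 - log v) := by
      rw [normalizedPotential]; ring
    simp only [hsub] at this
    dsimp only
    rw [← this]
  refine ⟨ContinuousOn.congr ?_ hT, StrictAntiOn.congr ?_ hT.symm⟩
  · have hJ : Continuous fun R => ∫ θ in (-(π / 2))..(π / 2), deriv g (R * sin θ) :=
      continuous_iff_continuousAt.2 fun R =>
        (hasDerivAt_integral_deriv_comp_mul_sin hg R).continuousAt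
    exact (continuous_const.mul (hJ.comp (by fun_prop : Continuous fun c : ℝ =>
      √(c - 1 / 2)))).continuousOn
  · intro c hc d hd hcd
    have hc' : 0 < c - 1 / 2 := sub_pos.2 hc
    have hd' : 0 < d - 1 / 2 := sub_pos.2 hd
    exact mul_lt_mul_of_pos_left (hanti (sqrt_pos.2 hc') (sqrt_pos.2 hd')
      (sqrt_lt_sqrt hc'.le (by linarith))) (by positivity)
end

section
/- Let φ(v) = v²/2 − log v on (0,∞) and, for c > 1/2, let T(c) = √2·∫_{c₁(c)}^{c₂(c)} dv/√(c − φ(v)), where c₁(c) ∈ (0,1) and c₂(c) ∈ (1,∞) are the two roots of φ(v) = c. Then for every c ∈ (1/2,∞) one has 2√2 ≤ T(c) < √2·π, and sup_{c > 1/2} T(c) = √2·π. -/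
open Real intervalIntegral

/-- The potential `φ(v) = v²/2 − log v`, shifted so that its minimum, at `v = 1`, is zero. -/
noncomputable def shiftedPotential (v : ℝ) : ℝ := (v ^ 2 - 1) / 2 - log v

local notation "ψ" => shiftedPotential

theorem lt_of_hasDerivAt_pos {f f' : ℝ → ℝ} {a b : ℝ} (hab : a < b)
    (hf : ∀ x ∈ Set.Icc a b, HasDerivAt f (f' x) x) (hpos : ∀ x ∈ Set.Ioo a b, 0 < f' x) :
    f a < f b := by
  obtain ⟨x, hx, hs⟩ := exists_hasDerivAt_eq_slope f f' hab
    (fun y hy => (hf y hy).continuousAt.continuousWithinAt)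
    (fun y hy => hf y (Set.Ioo_subset_Icc_self hy))
  have h := hpos x hx
  rw [hs, div_pos_iff_of_pos_right (sub_pos.2 hab)] at h
  linarith

theorem lt_of_hasDerivAt_neg {f f' : ℝ → ℝ} {a b : ℝ} (hab : a < b)
    (hf : ∀ x ∈ Set.Icc a b, HasDerivAt f (f' x) x) (hneg : ∀ x ∈ Set.Ioo a b, f' x < 0) :
    f b < f a := by
  have := lt_of_hasDerivAt_pos (f := fun x => -f x) (f' := fun x => -f' x) hab
    (fun x hx => (hf x hx).neg) (fun x hx => neg_pos.2 (hneg x hx))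
  linarith

/-- A nonnegative function dominated by the derivative of a continuous function is integrable. -/
theorem intervalIntegrable_of_le_deriv {f F F' : ℝ → ℝ} {a b : ℝ} (hab : a ≤ b)
    (hf : Measurable f) (hf0 : ∀ x, 0 ≤ f x) (hF : ContinuousOn F (Set.Icc a b))
    (hF' : ∀ x ∈ Set.Ioo a b, HasDerivAt F (F' x) x) (hle : ∀ x ∈ Set.Ioo a b, f x ≤ F' x) :
    IntervalIntegrable f MeasureTheory.volume a b := by
  have hint := integrableOn_deriv_of_nonneg hF hF' (fun x hx => (hf0 x).trans (hle x hx))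
  rw [intervalIntegrable_iff_integrableOn_Ioo_of_le hab]
  refine MeasureTheory.Integrable.mono' (hint.mono_set Set.Ioo_subset_Ioc_self)
    hf.aestronglyMeasurable ?_
  filter_upwards [MeasureTheory.ae_restrict_mem measurableSet_Ioo] with x hx
  rw [Real.norm_of_nonneg (hf0 x)]
  exact hle x hx

theorem intervalIntegral_le_of_le_deriv {f F F' : ℝ → ℝ} {a b : ℝ} (hab : a ≤ b)
    (hf : Measurable f) (hf0 : ∀ x, 0 ≤ f x) (hF : ContinuousOn F (Set.Icc a b))
    (hF' : ∀ x ∈ Set.Ioo a b, HasDerivAt F (F' x) x) (hle : ∀ x ∈ Set.Ioo a b, f x ≤ F' x) :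
    ∫ x in a..b, f x ≤ F b - F a := by
  have hint : IntervalIntegrable F' MeasureTheory.volume a b :=
    (intervalIntegrable_iff_integrableOn_Ioc_of_le hab).2
      (integrableOn_deriv_of_nonneg hF hF' (fun x hx => (hf0 x).trans (hle x hx)))
  rw [← integral_eq_sub_of_hasDerivAt_of_le hab hF hF' hint]
  exact integral_mono_on_of_le_Ioo hab (intervalIntegrable_of_le_deriv hab hf hf0 hF hF' hle)
    hint hle

theorem intervalIntegral_lt_of_lt_deriv {f F F' : ℝ → ℝ} {a b : ℝ} (hab : a < b)
    (hf : Measurable f) (hf0 : ∀ x, 0 ≤ f x) (hF : ContinuousOn F (Set.Icc a b))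
    (hF' : ∀ x ∈ Set.Ioo a b, HasDerivAt F (F' x) x) (hlt : ∀ x ∈ Set.Ioo a b, f x < F' x) :
    ∫ x in a..b, f x < F b - F a := by
  have hle : ∀ x ∈ Set.Ioo a b, f x ≤ F' x := fun x hx => (hlt x hx).le
  have hint : IntervalIntegrable F' MeasureTheory.volume a b :=
    (intervalIntegrable_iff_integrableOn_Ioc_of_le hab.le).2
      (integrableOn_deriv_of_nonneg hF hF' (fun x hx => (hf0 x).trans (hle x hx)))
  have hfint := intervalIntegrable_of_le_deriv hab.le hf hf0 hF hF' hle
  have hpos := intervalIntegral_pos_of_pos_on (hint.sub hfint)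
    (fun x hx => sub_pos.2 (hlt x hx)) hab
  rw [integral_sub hint hfint, integral_eq_sub_of_hasDerivAt_of_le hab.le hF hF' hint] at hpos
  linarith

theorem le_intervalIntegral_of_deriv_le {f F F' : ℝ → ℝ} {a b : ℝ} (hab : a ≤ b)
    (hf : IntervalIntegrable f MeasureTheory.volume a b) (hF : ContinuousOn F (Set.Icc a b))
    (hF' : ∀ x ∈ Set.Ioo a b, HasDerivAt F (F' x) x) (hpos : ∀ x ∈ Set.Ioo a b, 0 ≤ F' x)
    (hle : ∀ x ∈ Set.Ioo a b, F' x ≤ f x) :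
    F b - F a ≤ ∫ x in a..b, f x := by
  have hint : IntervalIntegrable F' MeasureTheory.volume a b :=
    (intervalIntegrable_iff_integrableOn_Ioc_of_le hab).2
      (integrableOn_deriv_of_nonneg hF hF' hpos)
  rw [← integral_eq_sub_of_hasDerivAt_of_le hab hF hF' hint]
  exact integral_mono_on_of_le_Ioo hab hint hf hle

theorem hasDerivAt_shiftedPotential {v : ℝ} (hv : 0 < v) : HasDerivAt ψ (v - 1 / v) v := by
  have h := (((hasDerivAt_pow 2 v).sub_const 1).div_const 2).sub (hasDerivAt_log hv.ne')
  refine h.congr_deriv ?_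
  simp

theorem shiftedPotential_one : ψ 1 = 0 := by simp [shiftedPotential]

theorem continuousOn_shiftedPotential {s : Set ℝ} (hs : ∀ x ∈ s, 0 < x) : ContinuousOn ψ s :=
  fun x hx => (hasDerivAt_shiftedPotential (hs x hx)).continuousAt.continuousWithinAt

theorem measurable_shiftedPotential : Measurable ψ := by
  unfold shiftedPotential
  fun_prop

theorem shiftedPotential_deriv_pos {v : ℝ} (hv : 1 < v) : 0 < v - 1 / v := by
  have : 1 / v < 1 := by rw [div_lt_one (by linarith)]; exact hv
  linarith

theorem shiftedPotential_deriv_neg {v : ℝ} (h0 : 0 < v) (hv : v < 1) : v - 1 / v < 0 := by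
  have : 1 < 1 / v := by rw [lt_div_iff₀ h0]; linarith
  linarith

theorem shiftedPotential_lt_of_one_le {x y : ℝ} (hx : 1 ≤ x) (hxy : x < y) : ψ x < ψ y :=
  lt_of_hasDerivAt_pos hxy (fun z hz => hasDerivAt_shiftedPotential (by linarith [hz.1]))
    (fun z hz => shiftedPotential_deriv_pos (by linarith [hz.1]))

theorem shiftedPotential_lt_of_le_one {x y : ℝ} (hx : 0 < x) (hxy : x < y) (hy : y ≤ 1) :
    ψ y < ψ x :=
  lt_of_hasDerivAt_neg hxy (fun z hz => hasDerivAt_shiftedPotential (by linarith [hz.1]))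
    (fun z hz => shiftedPotential_deriv_neg (by linarith [hz.1]) (by linarith [hz.2]))

theorem shiftedPotential_pos {v : ℝ} (h0 : 0 < v) (h1 : v ≠ 1) : 0 < ψ v := by
  rw [← shiftedPotential_one]
  rcases lt_or_gt_of_ne h1 with h | h
  · exact shiftedPotential_lt_of_le_one h0 h le_rfl
  · exact shiftedPotential_lt_of_one_le le_rfl h

theorem deriv_le_two_mul_sqrt_shiftedPotential {v : ℝ} (hv : 1 < v) :
    v - 1 / v ≤ 2 * √(ψ v) := by
  have key : (fun x : ℝ => x ^ 2 - (x ^ 2)⁻¹ - 4 * log x) 1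
      < (fun x : ℝ => x ^ 2 - (x ^ 2)⁻¹ - 4 * log x) v := by
    refine lt_of_hasDerivAt_pos
      (f := fun x : ℝ => x ^ 2 - (x ^ 2)⁻¹ - 4 * log x) (f' := fun x => 2 * x + 2 / x ^ 3 - 4 / x) hv ?_ ?_
    · intro x hx
      have hx0 : x ≠ 0 := by linarith [hx.1]
      have h := ((hasDerivAt_pow 2 x).sub ((hasDerivAt_pow 2 x).inv (pow_ne_zero 2 hx0))).sub
        ((hasDerivAt_log hx0).const_mul 4)
      refine h.congr_deriv ?_
      field_simp
      ring
    · intro x hx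
      have hx0 : 0 < x := by linarith [hx.1]
      have hp := shiftedPotential_deriv_pos hx.1
      have : 2 * x + 2 / x ^ 3 - 4 / x = 2 * (x - 1 / x) ^ 2 / x := by
        field_simp
        ring
      rw [this]
      positivity
  simp only [one_pow, inv_one, sub_self, log_one, mul_zero] at key
  have hs := sq_sqrt (shiftedPotential_pos (by linarith) hv.ne').le
  refine le_of_pow_le_pow_left₀ two_ne_zero (by positivity) ?_
  rw [mul_pow, hs]
  have : (v - 1 / v) ^ 2 = v ^ 2 - 2 + (v ^ 2)⁻¹ := by
    field_simp
    ring
  rw [this]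
  unfold shiftedPotential
  linarith

theorem two_mul_sqrt_shiftedPotential_le {v : ℝ} (hv : 1 < v) :
    2 * √(ψ v) ≤ √2 * (v - 1 / v) := by
  have hp := shiftedPotential_deriv_pos hv
  have hs := sq_sqrt (shiftedPotential_pos (by linarith) hv.ne').le
  refine le_of_pow_le_pow_left₀ two_ne_zero (by positivity) ?_
  rw [mul_pow, mul_pow, hs, sq_sqrt zero_le_two]
  have : (v - 1 / v) ^ 2 = v ^ 2 - 2 + (v ^ 2)⁻¹ := by
    field_simp
    ring
  have hlog := one_sub_inv_le_log_of_pos (x := v ^ 2) (by positivity)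
  rw [log_pow] at hlog
  push_cast at hlog
  rw [this]
  unfold shiftedPotential
  linarith

theorem mul_deriv_le_two_mul_sqrt_shiftedPotential {v : ℝ} (h0 : 0 < v) (hv : v < 1) :
    v * (1 / v - v) ≤ 2 * √(ψ v) := by
  have key : (fun x : ℝ => 2 * x ^ 2 - 2 - 4 * log x - (1 - x ^ 2) ^ 2) 1
      < (fun x : ℝ => 2 * x ^ 2 - 2 - 4 * log x - (1 - x ^ 2) ^ 2) v := by
    refine lt_of_hasDerivAt_neg
      (f := fun x : ℝ => 2 * x ^ 2 - 2 - 4 * log x - (1 - x ^ 2) ^ 2) (f' := fun x => -(4 * (1 - x ^ 2) ^ 2 / x)) hv ?_ ?_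
    · intro x hx
      have hx0 : x ≠ 0 := by linarith [hx.1]
      have h := ((((hasDerivAt_pow 2 x).const_mul 2).sub_const 2).sub
        ((hasDerivAt_log hx0).const_mul 4)).sub (((hasDerivAt_pow 2 x).const_sub 1).pow 2)
      refine h.congr_deriv ?_
      field_simp
      ring
    · intro x hx
      have hx0 : 0 < x := by linarith [hx.1]
      have : 0 < 1 - x ^ 2 := by nlinarith [hx.2]
      have : 0 < 4 * (1 - x ^ 2) ^ 2 / x := by positivity
      linarith
  have hs := sq_sqrt (shiftedPotential_pos h0 hv.ne).le
  refine le_of_pow_le_pow_left₀ two_ne_zero (by positivity) ?_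
  have : v * (1 / v - v) = 1 - v ^ 2 := by field_simp
  rw [this, mul_pow, hs]
  norm_num at key
  unfold shiftedPotential
  linarith

theorem tangentGap_deriv_factor_pos {v : ℝ} (h0 : 1 / 88 ≤ v) (h1 : v ≠ 1)
    (h6 : v - 1 / v < 6) :
    0 < 432 * (1 + 1 / v ^ 2) / (6 - (v - 1 / v)) ^ 3 - 4 := by
  have hv : 0 < v := by linarith
  have hpos : 0 < (v - 1) ^ 2 := by positivity [sub_ne_zero.2 h1]
  have hq : 0 < -1 + 88 * v + 72 * v ^ 2 - 16 * v ^ 3 + v ^ 4 := by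
    nlinarith [sq_nonneg (v * (v - 8)), pow_pos hv 2]
  have hfac : 108 * (1 + 1 / v ^ 2) - (6 - (v - 1 / v)) ^ 3
      = (v - 1) ^ 2 * (-1 + 88 * v + 72 * v ^ 2 - 16 * v ^ 3 + v ^ 4) / v ^ 3 := by
    field_simp
    ring
  have hd : 0 < (6 - (v - 1 / v)) ^ 3 := pow_pos (by linarith) 3
  have : 0 < 108 * (1 + 1 / v ^ 2) - (6 - (v - 1 / v)) ^ 3 := by
    rw [hfac]
    positivity
  rw [sub_pos, lt_div_iff₀ hd]
  linarith

/-- The square of `6p/(6 − p)` minus `4ψ`, where `p` is the derivative of `ψ`. Its sign decides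
whether `2√ψ` lies below the tangent bound `|p| (1 ± √ψ/3)`. -/
noncomputable def tangentGap (v : ℝ) : ℝ := (6 * (v - 1 / v) / (6 - (v - 1 / v))) ^ 2 - 4 * ψ v

theorem hasDerivAt_tangentGap {v : ℝ} (hv : 0 < v) (h6 : v - 1 / v < 6) :
    HasDerivAt tangentGap
      ((v - 1 / v) * (432 * (1 + 1 / v ^ 2) / (6 - (v - 1 / v)) ^ 3 - 4)) v := by
  have hp : HasDerivAt (fun x : ℝ => x - 1 / x) (1 + 1 / v ^ 2) v := by
    have h := (hasDerivAt_id v).sub (hasDerivAt_inv hv.ne')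
    simp only [one_div]
    refine h.congr_deriv ?_
    ring
  have hne : 6 - (v - 1 / v) ≠ 0 := by linarith
  have h := (((hp.const_mul 6).div (hp.const_sub 6) hne).pow 2).sub
    ((hasDerivAt_shiftedPotential hv).const_mul 4)
  refine h.congr_deriv ?_
  simp only [Pi.div_apply, Nat.cast_ofNat, Nat.add_one_sub_one, pow_one]
  generalize 1 + 1 / v ^ 2 = q
  generalize v - 1 / v = p at *
  field_simp
  ring

theorem tangentGap_one : tangentGap 1 = 0 := by simp [tangentGap, shiftedPotential_one]

theorem shiftedPotential_deriv_mono {x y : ℝ} (hx : 0 < x) (hxy : x ≤ y) :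
    x - 1 / x ≤ y - 1 / y := by
  have := one_div_le_one_div_of_le hx hxy
  linarith

theorem two_mul_sqrt_shiftedPotential_lt {v : ℝ} (hv : 1 < v) :
    2 * √(ψ v) < (v - 1 / v) * (1 + √(ψ v) / 3) := by
  have hp := shiftedPotential_deriv_pos hv
  have hψ := shiftedPotential_pos (by linarith) hv.ne'
  have hs := sq_sqrt hψ.le
  have hs0 := sqrt_pos.2 hψ
  rcases le_or_gt 6 (v - 1 / v) with h6 | h6
  · nlinarith
  have hlt : ∀ x ∈ Set.Icc 1 v, x - 1 / x < 6 := fun x hx =>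
    (shiftedPotential_deriv_mono (by linarith [hx.1]) hx.2).trans_lt h6
  have key := lt_of_hasDerivAt_pos hv
    (fun x hx => hasDerivAt_tangentGap (by linarith [hx.1]) (hlt x hx))
    (fun x hx => mul_pos (shiftedPotential_deriv_pos hx.1) (tangentGap_deriv_factor_pos
      (by linarith [hx.1]) hx.1.ne' (hlt x (Set.Ioo_subset_Icc_self hx))))
  rw [tangentGap_one] at key
  unfold tangentGap at key
  generalize v - 1 / v = p at *
  have hd : 0 < 6 - p := by linarith
  have : 2 * √(ψ v) < 6 * p / (6 - p) := by
    apply lt_of_pow_lt_pow_left₀ 2 (by positivity)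
    rw [mul_pow, hs]
    linarith
  rw [lt_div_iff₀ hd] at this
  linarith

theorem two_mul_sqrt_shiftedPotential_le_of_lt_one {v : ℝ} (h0 : 0 < v) (hv : v < 1)
    (h5 : ψ v ≤ 5) :
    2 * √(ψ v) ≤ -(v - 1 / v) * (1 - √(ψ v) / 3) := by
  have hp := shiftedPotential_deriv_neg h0 hv
  have hψ := shiftedPotential_pos h0 hv.ne
  have hs := sq_sqrt hψ.le
  have hs0 := sqrt_pos.2 hψ
  suffices h : 0 ≤ tangentGap v by
    unfold tangentGap at h
    generalize v - 1 / v = p at *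
    have hd : 0 < 6 - p := by linarith
    have hm : 0 < 6 * (-p) / (6 - p) := div_pos (by linarith) hd
    have : 2 * √(ψ v) ≤ 6 * (-p) / (6 - p) := by
      refine le_of_pow_le_pow_left₀ two_ne_zero hm.le ?_
      rw [mul_pow, hs]
      have : (6 * (-p) / (6 - p)) ^ 2 = (6 * p / (6 - p)) ^ 2 := by ring
      linarith
    rw [le_div_iff₀ hd] at this
    linarith
  rcases le_or_gt (1 / 88) v with h88 | h88
  · have key := lt_of_hasDerivAt_neg hv
      (fun x hx => hasDerivAt_tangentGap (by linarith [hx.1])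
        (by linarith [shiftedPotential_deriv_mono (by linarith [hx.1]) hx.2]))
      (fun x hx => mul_neg_of_neg_of_pos
        (shiftedPotential_deriv_neg (by linarith [hx.1]) hx.2) (tangentGap_deriv_factor_pos
        (by linarith [hx.1]) hx.2.ne
        (by linarith [shiftedPotential_deriv_neg (by linarith [hx.1]) hx.2])))
    rw [tangentGap_one] at key
    exact key.le
  · have hlt : v - 1 / v ≤ -18 := by
      have : 88 < 1 / v := by
        rw [lt_div_iff₀ h0]
        linarith
      linarith
    unfold tangentGap
    generalize v - 1 / v = p at *
    have : 9 / 2 ≤ 6 * (-p) / (6 - p) := by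
      rw [le_div_iff₀ (by linarith)]
      linarith
    have h2 : (6 * p / (6 - p)) ^ 2 = (6 * (-p) / (6 - p)) ^ 2 := by ring
    rw [h2]
    nlinarith

theorem hasDerivAt_arcsin_sqrt {v E : ℝ} (h0 : 0 < v) (h1 : v ≠ 1) (hE : ψ v < E) :
    HasDerivAt (fun x => arcsin √(ψ x / E)) ((v - 1 / v) / (2 * √(ψ v) * √(E - ψ v))) v := by
  have hψ := shiftedPotential_pos h0 h1
  have hE0 : 0 < E := hψ.trans hE
  have hlt : √(ψ v / E) < 1 := by
    rw [sqrt_lt' one_pos, one_pow, div_lt_one hE0]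
    exact hE
  have hpos : 0 < ψ v / E := div_pos hψ hE0
  have h := (hasDerivAt_arcsin (by linarith [sqrt_nonneg (ψ v / E)]) hlt.ne).comp v
    (((hasDerivAt_shiftedPotential h0).div_const E).sqrt hpos.ne')
  refine h.congr_deriv ?_
  have h2 : 1 - ψ v / E = (E - ψ v) / E := by field_simp
  have hr : 0 < √(E - ψ v) := sqrt_pos.2 (sub_pos.2 hE)
  have hs : 0 < √(ψ v) := sqrt_pos.2 hψ
  have he : 0 < √E := sqrt_pos.2 hE0
  rw [sq_sqrt hpos.le, h2, sqrt_div (sub_pos.2 hE).le, sqrt_div hψ.le]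
  generalize v - 1 / v = p
  field_simp
  rw [sq_sqrt hE0.le]

theorem hasDerivAt_sqrt_sub {v E : ℝ} (h0 : 0 < v) (hE : ψ v < E) :
    HasDerivAt (fun x => √(E - ψ x)) (-(v - 1 / v) / (2 * √(E - ψ v))) v :=
  ((hasDerivAt_shiftedPotential h0).const_sub E).sqrt (sub_pos.2 hE).ne'

theorem continuousOn_arcsin_sqrt {a b E : ℝ} (ha : 0 < a) :
    ContinuousOn (fun x => arcsin √(ψ x / E)) (Set.Icc a b) :=
  continuous_arcsin.comp_continuousOn
    ((continuousOn_shiftedPotential fun _ hx => ha.trans_le hx.1).div_const E).sqrt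

theorem continuousOn_sqrt_sub {a b E : ℝ} (ha : 0 < a) :
    ContinuousOn (fun x => √(E - ψ x)) (Set.Icc a b) :=
  (continuousOn_const.sub (continuousOn_shiftedPotential fun _ hx => ha.trans_le hx.1)).sqrt

theorem measurable_one_div_sqrt (E : ℝ) : Measurable fun v => 1 / √(E - ψ v) :=
  measurable_const.div (measurable_const.sub measurable_shiftedPotential).sqrt

theorem arcsin_sqrt_shiftedPotential_one (E : ℝ) : arcsin √(ψ 1 / E) = 0 := by
  simp [shiftedPotential_one]

theorem arcsin_sqrt_self {v E : ℝ} (hE : 0 < E) (h : ψ v = E) : arcsin √(ψ v / E) = π / 2 := by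
  rw [h, div_self hE.ne', sqrt_one, arcsin_one]

/-- The data of an oscillation of energy `E`: the turning points `a < 1 < b`. -/
structure IsTurningPair (a b E : ℝ) : Prop where
  left_pos : 0 < a
  left_lt : a < 1
  lt_right : 1 < b
  left_eq : ψ a = E
  right_eq : ψ b = E

namespace IsTurningPair

variable {a b E : ℝ}

theorem energy_pos (h : IsTurningPair a b E) : 0 < E :=
  h.left_eq ▸ shiftedPotential_pos h.left_pos h.left_lt.ne

theorem lt_energy_left (h : IsTurningPair a b E) {v : ℝ} (hv : v ∈ Set.Ioo a 1) : ψ v < E :=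
  h.left_eq ▸ shiftedPotential_lt_of_le_one h.left_pos hv.1 hv.2.le

theorem lt_energy_right (h : IsTurningPair a b E) {v : ℝ} (hv : v ∈ Set.Ioo 1 b) : ψ v < E :=
  h.right_eq ▸ shiftedPotential_lt_of_one_le hv.1.le hv.2

theorem lt_energy (h : IsTurningPair a b E) {v : ℝ} (hv : v ∈ Set.Ioo a b) : ψ v < E := by
  rcases lt_trichotomy v 1 with h1 | rfl | h1
  · exact h.lt_energy_left ⟨hv.1, h1⟩
  · exact shiftedPotential_one.trans_lt h.energy_pos
  · exact h.lt_energy_right ⟨h1, hv.2⟩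

theorem hasDerivAt_chord (ha : a < 1) (hE : 0 < E) {v : ℝ} (hv : a < v) :
    HasDerivAt (fun x => 2 * √((1 - a) * (x - a) / E)) (1 / √(E * (v - a) / (1 - a))) v := by
  have hd : 0 < 1 - a := sub_pos.2 ha
  have hva : 0 < v - a := sub_pos.2 hv
  have hpos : 0 < (1 - a) * (v - a) / E := by positivity
  have h := (((((hasDerivAt_id v).sub_const a).const_mul (1 - a)).div_const E).sqrt
    hpos.ne').const_mul 2
  refine h.congr_deriv ?_
  have hs := sqrt_pos.2 hpos
  have key : √(E * (v - a) / (1 - a)) = √((1 - a) * (v - a) / E) * (E / (1 - a)) := by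
    rw [← sqrt_sq (show 0 ≤ E / (1 - a) by positivity), ← sqrt_mul hpos.le]
    congr 1
    field_simp
  simp only [id]
  rw [key]
  field_simp

theorem one_div_sqrt_le_chord (h : IsTurningPair a b E) {v : ℝ} (hv : v ∈ Set.Ioo a 1) :
    1 / √(E - ψ v) ≤ 1 / √(E * (v - a) / (1 - a)) := by
  have hd : 0 < 1 - a := sub_pos.2 h.left_lt
  have hva : 0 < v - a := sub_pos.2 hv.1
  have hE := h.energy_pos
  refine one_div_le_one_div_of_le (sqrt_pos.2 (by positivity)) (sqrt_le_sqrt ?_)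
  have h1v : 0 ≤ (1 - v) / (1 - a) := div_nonneg (by linarith [hv.2]) hd.le
  have hva' : 0 ≤ (v - a) / (1 - a) := by positivity
  have hsum : (1 - v) / (1 - a) + (v - a) / (1 - a) = 1 := by
    field_simp
    ring
  have hlog := strictConcaveOn_log_Ioi.concaveOn.2 (Set.mem_Ioi.2 h.left_pos)
    (Set.mem_Ioi.2 one_pos) h1v hva' hsum
  simp only [smul_eq_mul, log_one, mul_zero, add_zero, mul_one] at hlog
  have hcomb : (1 - v) / (1 - a) * a + (v - a) / (1 - a) = v := by
    field_simp
    ring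
  rw [hcomb] at hlog
  have ha := h.left_eq
  unfold shiftedPotential at *
  have hquad : (v ^ 2 - 1) / 2 ≤ (1 - v) / (1 - a) * ((a ^ 2 - 1) / 2) := by
    rw [div_mul_eq_mul_div, le_div_iff₀ hd]
    nlinarith [mul_pos (mul_pos hd hva) (sub_pos.2 hv.2)]
  have hE' : (1 - v) / (1 - a) * E
      = (1 - v) / (1 - a) * ((a ^ 2 - 1) / 2) - (1 - v) / (1 - a) * log a := by
    rw [← ha]
    ring
  have : E * (v - a) / (1 - a) = E - (1 - v) / (1 - a) * E := by
    rw [eq_sub_of_add_eq hsum]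
    ring
  rw [this]
  linarith

theorem continuousOn_chord : ContinuousOn (fun x => 2 * √((1 - a) * (x - a) / E)) (Set.Icc a 1) :=
  Continuous.continuousOn (by fun_prop)

theorem intervalIntegrable_left (h : IsTurningPair a b E) :
    IntervalIntegrable (fun v => 1 / √(E - ψ v)) MeasureTheory.volume a 1 :=
  intervalIntegrable_of_le_deriv h.left_lt.le (measurable_one_div_sqrt E)
    (fun _ => by positivity) continuousOn_chord
    (fun _ hv => hasDerivAt_chord h.left_lt h.energy_pos hv.1)
    (fun _ hv => h.one_div_sqrt_le_chord hv)

theorem integral_left_le_chord (h : IsTurningPair a b E) :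
    ∫ v in a..1, 1 / √(E - ψ v) ≤ 2 / √E := by
  have key := intervalIntegral_le_of_le_deriv h.left_lt.le (measurable_one_div_sqrt E)
    (fun _ => by positivity) continuousOn_chord
    (fun _ hv => hasDerivAt_chord h.left_lt h.energy_pos hv.1)
    (fun _ hv => h.one_div_sqrt_le_chord hv)
  have hd : 0 < 1 - a := sub_pos.2 h.left_lt
  have hs := sqrt_pos.2 h.energy_pos
  rw [sub_self, mul_zero, zero_div, sqrt_zero, mul_zero, sub_zero,
    sqrt_div (by positivity), sqrt_mul_self hd.le] at key
  refine key.trans ?_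
  rw [← mul_div_assoc]
  gcongr
  linarith [h.left_pos]

theorem integral_left_le (h : IsTurningPair a b E) (hE : E ≤ 5) :
    ∫ v in a..1, 1 / √(E - ψ v) ≤ π / 2 - √E / 3 := by
  have key := intervalIntegral_le_of_le_deriv h.left_lt.le (measurable_one_div_sqrt E)
    (fun _ => by positivity)
    ((continuousOn_arcsin_sqrt (E := E) h.left_pos).neg.sub
      ((continuousOn_sqrt_sub (E := E) h.left_pos).div_const 3))
    (fun v hv => (hasDerivAt_arcsin_sqrt (h.left_pos.trans hv.1) hv.2.ne
      (h.lt_energy_left hv)).neg.sub ((hasDerivAt_sqrt_sub (h.left_pos.trans hv.1)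
      (h.lt_energy_left hv)).div_const 3))
    (fun v hv => by
      have hv0 := h.left_pos.trans hv.1
      have hlt := h.lt_energy_left hv
      have hs := sqrt_pos.2 (shiftedPotential_pos hv0 hv.2.ne)
      have hr := sqrt_pos.2 (sub_pos.2 hlt)
      have hb := two_mul_sqrt_shiftedPotential_le_of_lt_one hv0 hv.2 (by linarith)
      have : -((v - 1 / v) / (2 * √(ψ v) * √(E - ψ v))) - -(v - 1 / v) / (2 * √(E - ψ v)) / 3
          = -(v - 1 / v) * (1 - √(ψ v) / 3) / (2 * √(ψ v) * √(E - ψ v)) := by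
        generalize v - 1 / v = p
        field_simp
        ring
      rw [this, div_le_div_iff₀ hr (by positivity)]
      nlinarith)
  simp only [Pi.sub_apply, Pi.neg_apply] at key
  rw [arcsin_sqrt_shiftedPotential_one, arcsin_sqrt_self h.energy_pos h.left_eq,
    shiftedPotential_one, h.left_eq] at key
  simp only [sub_zero, sub_self, sqrt_zero] at key
  linarith

theorem integral_right_lt (h : IsTurningPair a b E) :
    ∫ v in 1..b, 1 / √(E - ψ v) < π / 2 + √E / 3 := by
  have key := intervalIntegral_lt_of_lt_deriv h.lt_right (measurable_one_div_sqrt E)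
    (fun _ => by positivity)
    ((continuousOn_arcsin_sqrt (E := E) one_pos).sub
      ((continuousOn_sqrt_sub (E := E) one_pos).div_const 3))
    (fun v hv => (hasDerivAt_arcsin_sqrt (one_pos.trans hv.1) hv.1.ne'
      (h.lt_energy_right hv)).sub ((hasDerivAt_sqrt_sub (one_pos.trans hv.1)
      (h.lt_energy_right hv)).div_const 3))
    (fun v hv => by
      have hv0 := one_pos.trans hv.1
      have hlt := h.lt_energy_right hv
      have hs := sqrt_pos.2 (shiftedPotential_pos hv0 hv.1.ne')
      have hr := sqrt_pos.2 (sub_pos.2 hlt)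
      have hb := two_mul_sqrt_shiftedPotential_lt hv.1
      have : (v - 1 / v) / (2 * √(ψ v) * √(E - ψ v)) - -(v - 1 / v) / (2 * √(E - ψ v)) / 3
          = (v - 1 / v) * (1 + √(ψ v) / 3) / (2 * √(ψ v) * √(E - ψ v)) := by
        generalize v - 1 / v = p
        field_simp
        ring
      rw [this, div_lt_div_iff₀ hr (by positivity)]
      nlinarith)
  simp only [Pi.sub_apply] at key
  rw [arcsin_sqrt_shiftedPotential_one, arcsin_sqrt_self h.energy_pos h.right_eq,
    shiftedPotential_one, h.right_eq] at key
  simp only [sub_zero, sub_self, sqrt_zero] at key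
  linarith

theorem one_div_sqrt_le_right (h : IsTurningPair a b E) {v : ℝ} (hv : v ∈ Set.Ioo 1 b) :
    1 / √(E - ψ v) ≤ √2 * ((v - 1 / v) / (2 * √(ψ v) * √(E - ψ v))) := by
  have hs := sqrt_pos.2 (shiftedPotential_pos (one_pos.trans hv.1) hv.1.ne')
  have hr := sqrt_pos.2 (sub_pos.2 (h.lt_energy_right hv))
  rw [← mul_div_assoc, div_le_div_iff₀ hr (by positivity)]
  nlinarith [two_mul_sqrt_shiftedPotential_le hv.1]

theorem intervalIntegrable_right (h : IsTurningPair a b E) :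
    IntervalIntegrable (fun v => 1 / √(E - ψ v)) MeasureTheory.volume 1 b :=
  intervalIntegrable_of_le_deriv h.lt_right.le (measurable_one_div_sqrt E)
    (fun _ => by positivity) ((continuousOn_arcsin_sqrt one_pos).const_mul √2)
    (fun _ hv => (hasDerivAt_arcsin_sqrt (one_pos.trans hv.1) hv.1.ne'
      (h.lt_energy_right hv)).const_mul √2) (fun _ hv => h.one_div_sqrt_le_right hv)

theorem integral_right_le (h : IsTurningPair a b E) :
    ∫ v in 1..b, 1 / √(E - ψ v) ≤ √2 * (π / 2) := by
  have key := intervalIntegral_le_of_le_deriv h.lt_right.le (measurable_one_div_sqrt E)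
    (fun _ => by positivity) ((continuousOn_arcsin_sqrt one_pos).const_mul √2)
    (fun _ hv => (hasDerivAt_arcsin_sqrt (one_pos.trans hv.1) hv.1.ne'
      (h.lt_energy_right hv)).const_mul √2) (fun _ hv => h.one_div_sqrt_le_right hv)
  rw [arcsin_sqrt_shiftedPotential_one, arcsin_sqrt_self h.energy_pos h.right_eq] at key
  linarith

theorem le_integral_right (h : IsTurningPair a b E) :
    π / 2 ≤ ∫ v in 1..b, 1 / √(E - ψ v) := by
  have key := le_intervalIntegral_of_deriv_le h.lt_right.le h.intervalIntegrable_right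
    (continuousOn_arcsin_sqrt one_pos)
    (fun _ hv => hasDerivAt_arcsin_sqrt (one_pos.trans hv.1) hv.1.ne' (h.lt_energy_right hv))
    (fun v hv => by
      have := shiftedPotential_deriv_pos hv.1
      positivity)
    (fun v hv => by
      have hs := sqrt_pos.2 (shiftedPotential_pos (one_pos.trans hv.1) hv.1.ne')
      have hr := sqrt_pos.2 (sub_pos.2 (h.lt_energy_right hv))
      rw [div_le_div_iff₀ (by positivity) hr]
      nlinarith [deriv_le_two_mul_sqrt_shiftedPotential hv.1])
  rw [arcsin_sqrt_shiftedPotential_one, arcsin_sqrt_self h.energy_pos h.right_eq] at key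
  linarith

theorem le_integral_left (h : IsTurningPair a b E) :
    a * (π / 2) ≤ ∫ v in a..1, 1 / √(E - ψ v) := by
  have key := le_intervalIntegral_of_deriv_le h.left_lt.le h.intervalIntegrable_left
    ((continuousOn_arcsin_sqrt (E := E) h.left_pos).const_mul (-a))
    (fun _ hv => (hasDerivAt_arcsin_sqrt (h.left_pos.trans hv.1) hv.2.ne
      (h.lt_energy_left hv)).const_mul (-a))
    (fun v hv => by
      have := shiftedPotential_deriv_neg (h.left_pos.trans hv.1) hv.2
      refine mul_nonneg_of_nonpos_of_nonpos (by linarith [h.left_pos]) ?_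
      exact div_nonpos_of_nonpos_of_nonneg this.le (by positivity))
    (fun v hv => by
      have hv0 := h.left_pos.trans hv.1
      have hs := sqrt_pos.2 (shiftedPotential_pos hv0 hv.2.ne)
      have hr := sqrt_pos.2 (sub_pos.2 (h.lt_energy_left hv))
      have hp := shiftedPotential_deriv_neg hv0 hv.2
      have hb := mul_deriv_le_two_mul_sqrt_shiftedPotential hv0 hv.2
      have : a * (1 / v - v) ≤ v * (1 / v - v) :=
        mul_le_mul_of_nonneg_right hv.1.le (by linarith)
      rw [← mul_div_assoc, div_le_div_iff₀ (by positivity) hr]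
      nlinarith)
  rw [arcsin_sqrt_shiftedPotential_one, arcsin_sqrt_self h.energy_pos h.left_eq] at key
  linarith

theorem intervalIntegrable (h : IsTurningPair a b E) :
    IntervalIntegrable (fun v => 1 / √(E - ψ v)) MeasureTheory.volume a b :=
  h.intervalIntegrable_left.trans h.intervalIntegrable_right

theorem integral_eq_add (h : IsTurningPair a b E) :
    ∫ v in a..b, 1 / √(E - ψ v)
      = (∫ v in a..1, 1 / √(E - ψ v)) + ∫ v in 1..b, 1 / √(E - ψ v) :=
  (integral_add_adjacent_intervals h.intervalIntegrable_left h.intervalIntegrable_right).symm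

theorem integral_lt_pi (h : IsTurningPair a b E) : ∫ v in a..b, 1 / √(E - ψ v) < π := by
  rw [h.integral_eq_add]
  rcases le_or_gt E 5 with hE | hE
  · linarith [h.integral_left_le hE, h.integral_right_lt]
  · have h5 : 2.236 ≤ √E := le_sqrt_of_sq_le (by norm_num; linarith)
    have hl : 2 / √E ≤ 2 / 2.236 := by gcongr
    have h2 : √2 ≤ 1.415 := by
      rw [sqrt_le_left (by norm_num)]
      norm_num
    have := h.integral_left_le_chord
    have := h.integral_right_le
    norm_num at hl h2
    nlinarith [pi_gt_d2]

theorem one_add_mul_le_integral (h : IsTurningPair a b E) :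
    (1 + a) * (π / 2) ≤ ∫ v in a..b, 1 / √(E - ψ v) := by
  rw [h.integral_eq_add]
  linarith [h.le_integral_left, h.le_integral_right]

theorem arcsin_le_integral (h : IsTurningPair a b E) :
    √2 * (π / 2 - arcsin (a / b)) ≤ ∫ v in a..b, 1 / √(E - ψ v) := by
  have hb : 0 < b := one_pos.trans h.lt_right
  have hab : a < b := h.left_lt.trans h.lt_right
  have hder : ∀ v ∈ Set.Ioo a b,
      HasDerivAt (fun x => √2 * arcsin (x / b)) (√2 / √(b ^ 2 - v ^ 2)) v := by
    intro v hv
    have hv0 := h.left_pos.trans hv.1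
    have hvb : v / b < 1 := (div_lt_one hb).2 hv.2
    have hd := ((hasDerivAt_arcsin (by linarith [div_pos hv0 hb]) hvb.ne).comp v
      ((hasDerivAt_id v).div_const b)).const_mul √2
    refine hd.congr_deriv ?_
    have hpos : 0 < b ^ 2 - v ^ 2 := by nlinarith [hv.2]
    have : 1 - (v / b) ^ 2 = (b ^ 2 - v ^ 2) / b ^ 2 := by field_simp
    rw [this, sqrt_div hpos.le, sqrt_sq hb.le]
    have := sqrt_pos.2 hpos
    field_simp
  have key := le_intervalIntegral_of_deriv_le hab.le h.intervalIntegrable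
    (Continuous.continuousOn (by fun_prop)) hder (fun v _ => by positivity)
    (fun v hv => by
      have hv0 := h.left_pos.trans hv.1
      have hpos : 0 < b ^ 2 - v ^ 2 := by nlinarith [hv.2]
      have hr := sub_pos.2 (h.lt_energy hv)
      have hlog : log v < log b := log_lt_log hv0 hv.2
      have hE := h.right_eq
      rw [div_le_div_iff₀ (sqrt_pos.2 hpos) (sqrt_pos.2 hr), one_mul, ← sqrt_mul zero_le_two]
      apply sqrt_le_sqrt
      unfold shiftedPotential at *
      linarith)
  rw [div_self hb.ne', arcsin_one] at key
  linarith

theorem nineteen_tenths_le_right (h : IsTurningPair a b E) (ha : a ≤ 7 / 25) : 19 / 10 ≤ b := by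
  by_contra! hb
  have h1 := shiftedPotential_lt_of_one_le h.lt_right.le hb
  have h2 : ψ (7 / 25) ≤ ψ a := by
    rcases ha.eq_or_lt with rfl | ha
    · rfl
    · exact (shiftedPotential_lt_of_le_one h.left_pos ha (by norm_num)).le
  have hlog : log (19 / 10) - log (7 / 25) = log (95 / 14) := by
    rw [← log_div (by norm_num) (by norm_num)]
    norm_num
  have hexp : 9 / 5 ≤ log (95 / 14) := by
    rw [le_log_iff_exp_le (by norm_num)]
    refine le_of_pow_le_pow_left₀ (n := 5) (by norm_num) (by norm_num) ?_
    rw [← exp_nat_mul]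
    calc exp (((5 : ℕ) : ℝ) * (9 / 5)) = exp 1 ^ 9 := by
          rw [← exp_nat_mul]
          norm_num
      _ ≤ 2.7182818286 ^ 9 := by gcongr; exact exp_one_lt_d9.le
      _ ≤ (95 / 14) ^ 5 := by norm_num
  have h12 := h.left_eq.trans h.right_eq.symm
  have h3 : ψ (7 / 25) < ψ (19 / 10) := by linarith
  unfold shiftedPotential at h3
  norm_num at h3 hlog
  linarith

theorem two_le_integral (h : IsTurningPair a b E) : 2 ≤ ∫ v in a..b, 1 / √(E - ψ v) := by
  rcases le_or_gt (7 / 25) a with ha | ha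
  · have := h.one_add_mul_le_integral
    nlinarith [pi_gt_d2]
  have hb := h.nineteen_tenths_le_right ha.le
  have hab : a / b ≤ 0.15 := by
    rw [div_le_iff₀ (by linarith)]
    linarith
  have hab0 : 0 < a / b := div_pos h.left_pos (by linarith)
  have h2 : √2 ≤ 1.415 := by
    rw [sqrt_le_left (by norm_num)]
    norm_num
  have h2' : 1.414 ≤ √2 := le_sqrt_of_sq_le (by norm_num)
  have hy : 0.1557 ≤ π / 2 - √2 := by linarith [pi_gt_d4]
  have hy' : π / 2 - √2 ≤ 0.16 := by linarith [pi_lt_d4]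
  have hsin := sin_gt_sub_cube (x := π / 2 - √2) (by linarith)
  have hcube : (π / 2 - √2) ^ 3 ≤ 0.16 ^ 3 := by gcongr
  have harc : arcsin (a / b) ≤ π / 2 - √2 := by
    rw [arcsin_le_iff_le_sin ⟨by linarith, by linarith⟩
      ⟨by linarith, by linarith [sqrt_nonneg 2]⟩]
    linarith
  have hsq := mul_self_sqrt (zero_le_two (α := ℝ))
  have := h.arcsin_le_integral
  nlinarith

end IsTurningPair


/-- with `φ(v) = v²/2 − log v` and, for `c > 1/2`,
`c₁(c) ∈ (0,1)`, `c₂(c) ∈ (1,∞)` the two roots of `φ(v) = c`, the period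
function `T(c) = √2·∫_{c₁(c)}^{c₂(c)} dv/√(c − φ(v))` satisfies
`2√2 ≤ T(c) < √2·π` for every `c > 1/2`, and `sup_{c>1/2} T(c) = √2·π`. -/
theorem stmt_13 (c₁ c₂ : ℝ → ℝ)
    (h : ∀ c ∈ Set.Ioi (1/2 : ℝ),
      c₁ c ∈ Set.Ioo (0:ℝ) 1 ∧ c₂ c ∈ Set.Ioi (1:ℝ) ∧
      (c₁ c) ^ 2 / 2 - Real.log (c₁ c) = c ∧ (c₂ c) ^ 2 / 2 - Real.log (c₂ c) = c) :
    (∀ c ∈ Set.Ioi (1/2 : ℝ),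
      2 * Real.sqrt 2 ≤
        Real.sqrt 2 * ∫ v in (c₁ c)..(c₂ c), 1 / Real.sqrt (c - (v ^ 2 / 2 - Real.log v)) ∧
      Real.sqrt 2 * ∫ v in (c₁ c)..(c₂ c), 1 / Real.sqrt (c - (v ^ 2 / 2 - Real.log v)) <
        Real.sqrt 2 * π) ∧
    IsLUB
      ((fun c : ℝ =>
          Real.sqrt 2 * ∫ v in (c₁ c)..(c₂ c), 1 / Real.sqrt (c - (v ^ 2 / 2 - Real.log v)))
        '' Set.Ioi (1/2 : ℝ))
      (Real.sqrt 2 * π) := by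
  have hpair : ∀ c ∈ Set.Ioi (1/2 : ℝ), IsTurningPair (c₁ c) (c₂ c) (c - 1 / 2) := by
    intro c hc
    obtain ⟨h1, h2, h3, h4⟩ := h c hc
    refine ⟨h1.1, h1.2, h2, ?_, ?_⟩ <;> unfold shiftedPotential <;> linarith
  have hint : ∀ c : ℝ, ∫ v in (c₁ c)..(c₂ c), 1 / √(c - (v ^ 2 / 2 - log v))
      = ∫ v in (c₁ c)..(c₂ c), 1 / √(c - 1 / 2 - ψ v) := by
    intro c
    congr 1 with v
    unfold shiftedPotential
    ring_nf
  simp only [hint]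
  have h2 : 0 < √2 := sqrt_pos.2 two_pos
  refine ⟨fun c hc => ⟨?_, mul_lt_mul_of_pos_left (hpair c hc).integral_lt_pi h2⟩, ?_, ?_⟩
  · rw [mul_comm]
    exact mul_le_mul_of_nonneg_left (hpair c hc).two_le_integral h2.le
  · rintro _ ⟨c, hc, rfl⟩
    exact mul_le_mul_of_nonneg_left (hpair c hc).integral_lt_pi.le h2.le
  · intro u hu
    have hbound : ∀ a ∈ Set.Ioo (0 : ℝ) 1, √2 * ((1 + a) * (π / 2)) ≤ u := by
      intro a ha
      have hc : ψ a + 1 / 2 ∈ Set.Ioi (1 / 2 : ℝ) := by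
        simpa using shiftedPotential_pos ha.1 ha.2.ne
      have hp := hpair _ hc
      have heq : c₁ (ψ a + 1 / 2) = a := by
        have hE := hp.left_eq
        rw [add_sub_cancel_right] at hE
        rcases lt_trichotomy (c₁ (ψ a + 1 / 2)) a with hlt | heq | hgt
        · exact absurd hE (shiftedPotential_lt_of_le_one hp.left_pos hlt ha.2.le).ne'
        · exact heq
        · exact absurd hE (shiftedPotential_lt_of_le_one ha.1 hgt hp.left_lt.le).ne
      have hle := hp.one_add_mul_le_integral
      have hmul := (mul_le_mul_of_nonneg_left hle h2.le).trans (hu ⟨_, hc, rfl⟩)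
      rwa [heq] at hmul
    have hlim : Filter.Tendsto (fun a : ℝ => √2 * ((1 + a) * (π / 2))) (nhdsWithin 1 (Set.Iio 1))
        (nhds (√2 * ((1 + 1) * (π / 2)))) :=
      (Continuous.tendsto (by fun_prop) 1).mono_left nhdsWithin_le_nhds
    have := le_of_tendsto hlim (Filter.eventually_of_mem (Ioo_mem_nhdsLT one_pos) hbound)
    linarith
end

section
/- Let φ(v) = v²/2 − log v on (0,∞) and, for c > 1/2, let T(c) = √2·∫_{c₁(c)}^{c₂(c)} dv/√(c − φ(v)), where c₁(c) ∈ (0,1) and c₂(c) ∈ (1,∞) are the two roots of φ(v) = c. Then the set {c ∈ (1/2,∞) : T(c)/(2π) ∈ ℚ} is countable and dense in (1/2,∞). -/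
open Real intervalIntegral

section

open Set MeasureTheory Filter Topology

/-- The potential `p - 1 - log p`, which is twice `φ - 1/2` in the variable `p = v²`. -/
noncomputable def potential (p : ℝ) : ℝ := p - 1 - log p

theorem hasStrictDerivAt_potential {p : ℝ} (hp : p ≠ 0) :
    HasStrictDerivAt potential (1 - p⁻¹) p :=
  ((hasStrictDerivAt_id p).sub_const 1).sub (Real.hasStrictDerivAt_log hp)

theorem continuousOn_potential : ContinuousOn potential (Ioi 0) := fun _ hp =>
  (hasStrictDerivAt_potential (ne_of_gt hp)).hasDerivAt.continuousAt.continuousWithinAt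

theorem potential_strictMonoOn : StrictMonoOn potential (Ici 1) := by
  refine strictMonoOn_of_deriv_pos (convex_Ici 1)
    (continuousOn_potential.mono fun p (hp : 1 ≤ p) => lt_of_lt_of_le one_pos hp) fun p hp => ?_
  rw [interior_Ici, mem_Ioi] at hp
  rw [(hasStrictDerivAt_potential (by positivity)).hasDerivAt.deriv]
  exact sub_pos.2 (inv_lt_one_of_one_lt₀ hp)

theorem potential_strictAntiOn : StrictAntiOn potential (Ioc 0 1) := by
  refine strictAntiOn_of_deriv_neg (convex_Ioc 0 1)
    (continuousOn_potential.mono fun p hp => hp.1) fun p hp => ?_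
  rw [interior_Ioc] at hp
  rw [(hasStrictDerivAt_potential hp.1.ne').hasDerivAt.deriv]
  exact sub_neg.2 ((one_lt_inv₀ hp.1).2 hp.2)

theorem potential_one : potential 1 = 0 := by simp [potential]

theorem exp_potential {p : ℝ} (hp : 0 < p) : exp (potential p) = exp (p - 1) / p := by
  rw [potential, exp_sub, exp_log hp]

/-- `p` assigns to each positive level `δ` the root in `B` of `potential = δ`. -/
structure IsBranch (B : Set ℝ) (p : ℝ → ℝ) : Prop where
  isOpen : IsOpen B
  pos : ∀ u ∈ B, 0 < u
  potential_pos : ∀ u ∈ B, 0 < potential u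
  injOn : InjOn potential B
  mem : ∀ δ, 0 < δ → p δ ∈ B
  potential_eq : ∀ δ, 0 < δ → potential (p δ) = δ

namespace IsBranch

variable {B : Set ℝ} {p : ℝ → ℝ}

theorem apply_potential (hp : IsBranch B p) {u : ℝ} (hu : u ∈ B) : p (potential u) = u :=
  hp.injOn (hp.mem _ (hp.potential_pos u hu)) hu (hp.potential_eq _ (hp.potential_pos u hu))

theorem ne_one (hp : IsBranch B p) {u : ℝ} (hu : u ∈ B) : u ≠ 1 := by
  rintro rfl
  exact (hp.potential_pos 1 hu).ne' potential_one

theorem hasDerivAt (hp : IsBranch B p) {δ : ℝ} (hδ : 0 < δ) :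
    HasDerivAt p (p δ / (p δ - 1)) δ := by
  have hm := hp.mem δ hδ
  have h0 := (hp.pos _ hm).ne'
  have h1 := sub_ne_zero.2 (hp.ne_one hm)
  have hd : (1 - (p δ)⁻¹) = (p δ - 1) / p δ := by field_simp
  have := (hasStrictDerivAt_potential h0).to_local_left_inverse (g := p)
    (by rw [hd]; exact div_ne_zero h1 h0)
    (by filter_upwards [hp.isOpen.mem_nhds hm] with u hu using hp.apply_potential hu)
  rw [hp.potential_eq δ hδ, hd, inv_div] at this
  exact this.hasDerivAt

theorem continuousOn (hp : IsBranch B p) : ContinuousOn p (Ioi 0) := fun _ hδ =>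
  (hp.hasDerivAt hδ).continuousAt.continuousWithinAt

theorem exp_neg_eq (hp : IsBranch B p) {δ : ℝ} (hδ : 0 < δ) :
    exp (-δ) = p δ * exp (1 - p δ) := by
  have h0 := hp.pos _ (hp.mem δ hδ)
  conv_lhs => rw [← hp.potential_eq δ hδ]
  rw [exp_neg, exp_potential h0, inv_div, ← neg_sub (p δ) 1, exp_neg]
  rfl

end IsBranch

/-- The contribution of one branch to the integrand of the period. -/
noncomputable def branchWeight (p : ℝ → ℝ) (δ : ℝ) : ℝ :=
  p δ / |p δ - 1| * √(1 - exp (-δ))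

theorem branchWeight_nonneg {B : Set ℝ} {p : ℝ → ℝ} (hp : IsBranch B p) {δ : ℝ} (hδ : 0 < δ) :
    0 ≤ branchWeight p δ := by
  have h0 := hp.pos _ (hp.mem δ hδ)
  unfold branchWeight
  positivity

theorem branchWeight_le_two {B : Set ℝ} {p : ℝ → ℝ} (hp : IsBranch B p) {δ : ℝ} (hδ : 0 < δ) :
    branchWeight p δ ≤ 2 := by
  have hm := hp.mem δ hδ
  have h0 := hp.pos _ hm
  have h1 : 0 < |p δ - 1| := abs_pos.2 (sub_ne_zero.2 (hp.ne_one hm))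
  have hn1 : √(1 - exp (-δ)) ≤ 1 := Real.sqrt_le_one.2 (by linarith [exp_pos (-δ)])
  have hn2 : √(1 - exp (-δ)) ≤ |p δ - 1| := by
    rw [← Real.sqrt_sq_eq_abs]
    refine Real.sqrt_le_sqrt ?_
    rw [hp.exp_neg_eq hδ]
    nlinarith [add_one_le_exp (1 - p δ)]
  have hle : p δ ≤ 1 + |p δ - 1| := by linarith [le_abs_self (p δ - 1)]
  rw [branchWeight, div_mul_eq_mul_div, div_le_iff₀ h1]
  nlinarith [Real.sqrt_nonneg (1 - exp (-δ))]

theorem continuousOn_branchWeight {B : Set ℝ} {p : ℝ → ℝ} (hp : IsBranch B p) :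
    ContinuousOn (branchWeight p) (Ioi 0) := by
  refine (hp.continuousOn.div (hp.continuousOn.sub continuousOn_const).abs fun δ hδ => ?_).mul
    (by fun_prop)
  exact abs_ne_zero.2 (sub_ne_zero.2 (hp.ne_one (hp.mem δ hδ)))

theorem isBranch_lower {p : ℝ → ℝ}
    (hp : ∀ δ, 0 < δ → p δ ∈ Ioo (0 : ℝ) 1 ∧ potential (p δ) = δ) : IsBranch (Ioo 0 1) p where
  isOpen := isOpen_Ioo
  pos _ hu := hu.1
  potential_pos u hu := by
    rw [← potential_one]
    exact potential_strictAntiOn ⟨hu.1, hu.2.le⟩ ⟨one_pos, le_rfl⟩ hu.2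
  injOn := potential_strictAntiOn.injOn.mono Ioo_subset_Ioc_self
  mem δ hδ := (hp δ hδ).1
  potential_eq δ hδ := (hp δ hδ).2

theorem isBranch_upper {p : ℝ → ℝ}
    (hp : ∀ δ, 0 < δ → p δ ∈ Ioi (1 : ℝ) ∧ potential (p δ) = δ) : IsBranch (Ioi 1) p where
  isOpen := isOpen_Ioi
  pos _ hu := one_pos.trans hu
  potential_pos u hu := by
    rw [← potential_one]
    exact potential_strictMonoOn self_mem_Ici (mem_Ici.2 (le_of_lt hu)) hu
  injOn := potential_strictMonoOn.injOn.mono Ioi_subset_Ici_self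
  mem δ hδ := (hp δ hδ).1
  potential_eq δ hδ := (hp δ hδ).2

theorem potential_inv_lt {q : ℝ} (hq : 1 < q) : potential q⁻¹ < potential q := by
  have hanti : StrictMonoOn (fun q => potential q - potential q⁻¹) (Ici 1) := by
    have hd : ∀ q : ℝ, 1 ≤ q → HasDerivAt (fun q => potential q - potential q⁻¹)
        ((1 - q⁻¹) - (1 - q⁻¹⁻¹) * (-(q ^ 2)⁻¹)) q := fun q hq => by
      have h0 : q ≠ 0 := by positivity
      exact (hasStrictDerivAt_potential h0).hasDerivAt.sub
        ((hasStrictDerivAt_potential (inv_ne_zero h0)).hasDerivAt.comp q (hasDerivAt_inv h0))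
    refine strictMonoOn_of_deriv_pos (convex_Ici 1)
      (fun q hq => (hd q hq).continuousAt.continuousWithinAt) fun q hq => ?_
    rw [interior_Ici, mem_Ioi] at hq
    rw [(hd q hq.le).deriv]
    have : (1 - q⁻¹) - (1 - q⁻¹⁻¹) * (-(q ^ 2)⁻¹) = (q - 1) ^ 2 / q ^ 2 := by
      have : q ≠ 0 := by positivity
      field_simp
      ring
    rw [this]
    have := sub_pos.2 hq
    positivity
  have := hanti self_mem_Ici hq.le hq
  simp only [inv_one, sub_self] at this
  linarith

theorem potential_reflect_lt {q : ℝ} (h0 : 0 < q) (h1 : q < 1) :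
    potential (2 - q) < potential q := by
  have hmono : StrictAntiOn (fun q => potential q - potential (2 - q)) (Ioc 0 1) := by
    have hd : ∀ q ∈ Ioc (0 : ℝ) 1, HasDerivAt (fun q => potential q - potential (2 - q))
        ((1 - q⁻¹) - (1 - (2 - q)⁻¹) * (-1)) q := fun q hq => by
      have h2 : 2 - q ≠ 0 := by linarith [hq.2]
      exact (hasStrictDerivAt_potential hq.1.ne').hasDerivAt.sub
        ((hasStrictDerivAt_potential h2).hasDerivAt.comp q ((hasDerivAt_id q).const_sub 2))
    refine strictAntiOn_of_deriv_neg (convex_Ioc 0 1)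
      (fun q hq => (hd q hq).continuousAt.continuousWithinAt) fun q hq => ?_
    rw [interior_Ioc] at hq
    rw [(hd q ⟨hq.1, hq.2.le⟩).deriv]
    have h0 := hq.1
    have h2 : 0 < 2 - q := by linarith [hq.2]
    have : (1 - q⁻¹) - (1 - (2 - q)⁻¹) * (-1) = -(2 * (1 - q) ^ 2 / (q * (2 - q))) := by
      field_simp
      ring
    rw [this]
    have := sub_pos.2 hq.2
    exact neg_neg_of_pos (by positivity)
  have := hmono ⟨h0, h1.le⟩ ⟨one_pos, le_rfl⟩ h1
  norm_num at this
  linarith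

theorem exp_sub_mul_lower_bound {x r : ℝ} (hx : 0 < x) (h0 : 0 < r) (h1 : r < 1) :
    r * (1 + 2 * x - r ^ 2) ^ 2 < 2 * (exp x - r) * (1 - r ^ 2 + 2 * x * r ^ 2) := by
  have he := Real.quadratic_le_exp_of_nonneg hx.le
  have hr := sub_pos.2 h1
  have hpoly : 2 * (1 + x + x ^ 2 / 2 - r) * (1 - r ^ 2 + 2 * x * r ^ 2)
      - r * (1 + 2 * x - r ^ 2) ^ 2 = (1 - r) ^ 3 * (1 + r) * (2 + r)
        + 2 * x * ((1 - r) - r * x) ^ 2 + (1 - r) * (1 + r) * x ^ 2 := by ring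
  have hpos : 0 < (1 - r) ^ 3 * (1 + r) * (2 + r)
        + 2 * x * ((1 - r) - r * x) ^ 2 + (1 - r) * (1 + r) * x ^ 2 := by positivity
  have hfac : 0 ≤ 1 - r ^ 2 + 2 * x * r ^ 2 := by nlinarith [mul_pos hx (pow_pos h0 2)]
  nlinarith [mul_le_mul_of_nonneg_right he hfac]

/-- The two roots at a common level satisfy the inequality that makes the period decrease. -/
theorem two_root_inequality {δ p q : ℝ} (hp0 : 0 < p) (hp1 : p < 1) (hq : 1 < q)
    (hpδ : potential p = δ) (hqδ : potential q = δ) :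
    ((1 - p) * (q - 1)) ^ 2 <
      2 * (exp δ - 1) * (1 - p * q + (p + q - 2) * (p * q)) := by
  have hq0 : 0 < q := one_pos.trans hq
  have hsum : 0 < p + q - 2 := by
    by_contra! hle
    have := potential_strictMonoOn.monotoneOn hq.le (show 1 ≤ 2 - p by linarith)
      (show q ≤ 2 - p by linarith)
    linarith [potential_reflect_lt hp0 hp1]
  have hprod : p * q < 1 := by
    by_contra! hle
    have hle' : q⁻¹ ≤ p := by rwa [inv_le_iff_one_le_mul₀ hq0]
    have := potential_strictAntiOn.antitoneOn ⟨inv_pos.2 hq0, inv_le_one_of_one_le₀ hq.le⟩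
      ⟨hp0, hp1.le⟩ hle'
    linarith [potential_inv_lt hq]
  have hpq : 0 < p * q := mul_pos hp0 hq0
  set r := √(p * q) with hr
  have hr0 : 0 < r := Real.sqrt_pos.2 hpq
  have hr1 : r < 1 := by rw [hr, Real.sqrt_lt' one_pos]; simpa using hprod
  have hr2 : r ^ 2 = p * q := Real.sq_sqrt hpq.le
  have hexp : exp δ = exp ((p + q - 2) / 2) / r := by
    have hlog : log r = (log p + log q) / 2 := by
      rw [hr, Real.log_sqrt hpq.le, Real.log_mul hp0.ne' hq0.ne']
    have : δ = (p + q - 2) / 2 - log r := by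
      rw [hlog]
      unfold potential at hpδ hqδ
      linarith
    rw [this, exp_sub, exp_log hr0]
  have key := exp_sub_mul_lower_bound (half_pos hsum) hr0 hr1
  have hD : (1 - p) * (q - 1) = 1 + 2 * ((p + q - 2) / 2) - r ^ 2 := by rw [hr2]; ring
  have hN : 1 - p * q + (p + q - 2) * (p * q) = 1 - r ^ 2 + 2 * ((p + q - 2) / 2) * r ^ 2 := by
    rw [hr2]; ring
  rw [hD, hN, hexp, div_sub_one hr0.ne',
    show ∀ a b : ℝ, 2 * (a / r) * b = 2 * a * b / r from fun a b => by ring, lt_div_iff₀ hr0]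
  linarith

theorem branchWeight_add_strictAntiOn {p q : ℝ → ℝ} (hp : IsBranch (Ioo 0 1) p)
    (hq : IsBranch (Ioi 1) q) :
    StrictAntiOn (fun δ => branchWeight p δ + branchWeight q δ) (Ioi 0) := by
  set K : ℝ → ℝ := fun δ => 1 / (q δ - 1) - 1 / (p δ - 1) with hK
  have hKpos : ∀ δ, 0 < δ → 0 < K δ := fun δ hδ => by
    have h1 := sub_pos.2 (show 1 < q δ from hq.mem δ hδ)
    have h2 : 0 < 1 - p δ := sub_pos.2 (hp.mem δ hδ).2
    have : K δ = 1 / (q δ - 1) + 1 / (1 - p δ) := by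
      simp only [hK]
      rw [← neg_sub 1 (p δ), div_neg, sub_neg_eq_add]
    rw [this]
    positivity
  have hsum : ∀ δ, 0 < δ →
      branchWeight p δ + branchWeight q δ = √(K δ ^ 2 * (1 - exp (-δ))) := fun δ hδ => by
    have h1 := sub_pos.2 (show 1 < q δ from hq.mem δ hδ)
    have h2 : p δ - 1 < 0 := sub_neg.2 (hp.mem δ hδ).2
    rw [Real.sqrt_mul (sq_nonneg _), Real.sqrt_sq (hKpos δ hδ).le, branchWeight, branchWeight,
      abs_of_pos h1, abs_of_neg h2, ← add_mul, hK]
    congr 1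
    have := h2.ne
    have := h1.ne'
    field_simp
    ring
  have hderiv : ∀ δ, 0 < δ → HasDerivAt (fun δ => K δ ^ 2 * (1 - exp (-δ)))
      (2 * K δ * (-(q δ / (q δ - 1)) / (q δ - 1) ^ 2 + (p δ / (p δ - 1)) / (p δ - 1) ^ 2)
        * (1 - exp (-δ)) + K δ ^ 2 * exp (-δ)) δ := fun δ hδ => by
    have h1 := (sub_pos.2 (show 1 < q δ from hq.mem δ hδ)).ne'
    have h2 : p δ - 1 ≠ 0 := (sub_neg.2 (hp.mem δ hδ).2).ne
    have hKd : HasDerivAt K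
        (-(q δ / (q δ - 1)) / (q δ - 1) ^ 2 + (p δ / (p δ - 1)) / (p δ - 1) ^ 2) δ := by
      have := (((hq.hasDerivAt hδ).sub_const 1).fun_inv h1).sub
        (((hp.hasDerivAt hδ).sub_const 1).fun_inv h2)
      simp only [hK, one_div]
      exact (this.congr_deriv (by ring))
    exact ((hKd.fun_pow 2).mul (((hasDerivAt_neg δ).exp).const_sub 1)).congr_deriv (by simp)
  have hanti : StrictAntiOn (fun δ => K δ ^ 2 * (1 - exp (-δ))) (Ioi 0) := by
    refine strictAntiOn_of_deriv_neg (convex_Ioi 0)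
      (fun δ hδ => (hderiv δ hδ).continuousAt.continuousWithinAt) fun δ hδ => ?_
    rw [interior_Ioi] at hδ
    rw [(hderiv δ hδ).deriv]
    have hqm : 1 < q δ := hq.mem δ hδ
    have h1 := sub_pos.2 hqm
    obtain ⟨hpm0, hpm1⟩ := hp.mem δ hδ
    have h2 : 0 < 1 - p δ := sub_pos.2 hpm1
    have key := two_root_inequality hpm0 hpm1 hqm (hp.potential_eq δ hδ) (hq.potential_eq δ hδ)
    have hfac : 2 * K δ * (-(q δ / (q δ - 1)) / (q δ - 1) ^ 2 + (p δ / (p δ - 1)) / (p δ - 1) ^ 2)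
          * (1 - exp (-δ)) + K δ ^ 2 * exp (-δ) = K δ ^ 2 * exp (-δ) / ((1 - p δ) * (q δ - 1)) ^ 2 *
        (((1 - p δ) * (q δ - 1)) ^ 2 -
          2 * (exp δ - 1) * (1 - p δ * q δ + (p δ + q δ - 2) * (p δ * q δ))) := by
      have h3 : p δ - 1 ≠ 0 := by linarith
      have hKe : K δ = (q δ - p δ) / ((1 - p δ) * (q δ - 1)) := by
        simp only [hK]
        rw [← neg_sub 1 (p δ)]
        field_simp
        ring
      have h4 : p δ - 1 = -(1 - p δ) := by ring
      rw [hKe, h4, Real.exp_neg]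
      field_simp
      ring
    rw [hfac]
    have := hKpos δ hδ
    exact mul_neg_of_pos_of_neg (by positivity) (sub_neg.2 key)
  intro a ha b hb hab
  simp only [hsum a ha, hsum b hb]
  refine Real.sqrt_lt_sqrt (mul_nonneg (sq_nonneg _) ?_) (hanti ha hb hab)
  exact sub_nonneg.2 (Real.exp_le_one_iff.2 (neg_nonpos.2 (le_of_lt hb)))

/-- The level `δ'` with `exp δ' - 1 = (exp δ - 1) sin² θ`. -/
noncomputable def level (δ θ : ℝ) : ℝ := log (1 + (exp δ - 1) * sin θ ^ 2)

theorem sin_mem_Ioo {θ : ℝ} (hθ : θ ∈ Ioo 0 (π / 2)) : sin θ ∈ Ioo (0 : ℝ) 1 := by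
  refine ⟨sin_pos_of_pos_of_lt_pi hθ.1 (by linarith [hθ.2, pi_pos]), ?_⟩
  rw [← sin_pi_div_two]
  exact sin_lt_sin_of_lt_of_le_pi_div_two (by linarith [hθ.1, pi_pos]) le_rfl hθ.2

theorem exp_sub_one_pos {δ : ℝ} (hδ : 0 < δ) : 0 < exp δ - 1 := sub_pos.2 (one_lt_exp_iff.2 hδ)

theorem exp_level {δ : ℝ} (hδ : 0 < δ) (θ : ℝ) :
    exp (level δ θ) = 1 + (exp δ - 1) * sin θ ^ 2 := by
  have := exp_sub_one_pos hδ
  exact exp_log (by positivity)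

theorem level_pos {δ θ : ℝ} (hδ : 0 < δ) (hθ : 0 < sin θ) : 0 < level δ θ := by
  have := exp_sub_one_pos hδ
  exact log_pos (lt_add_of_pos_right _ (by positivity))

theorem level_lt {δ θ : ℝ} (hδ : 0 < δ) (hθ : θ ∈ Ioo 0 (π / 2)) : level δ θ < δ := by
  obtain ⟨h0, h1⟩ := sin_mem_Ioo hθ
  rw [← exp_lt_exp, exp_level hδ]
  nlinarith [mul_pos (exp_sub_one_pos hδ) (sub_pos.2 (pow_lt_one₀ h0.le h1 two_ne_zero))]

theorem level_lt_level {δ δ' θ : ℝ} (hδ : 0 < δ) (h : δ < δ') (hθ : 0 < sin θ) :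
    level δ θ < level δ' θ := by
  rw [← exp_lt_exp, exp_level hδ, exp_level (hδ.trans h)]
  have := exp_lt_exp.2 h
  gcongr

theorem hasDerivAt_level {δ : ℝ} (hδ : 0 < δ) (θ : ℝ) : HasDerivAt (level δ)
    ((exp δ - 1) * (2 * sin θ * cos θ) / (1 + (exp δ - 1) * sin θ ^ 2)) θ := by
  have := exp_sub_one_pos hδ
  exact (((((hasDerivAt_sin θ).fun_pow 2).const_mul (exp δ - 1)).const_add 1).log
    (by positivity)).congr_deriv (by simp)

/-- The parametrization by an angle of the part of the period interval lying on one branch. -/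
noncomputable def branchMap (p : ℝ → ℝ) (δ θ : ℝ) : ℝ := exp ((p (level δ θ) - 1 - δ) / 2)

section branchMap

variable {B : Set ℝ} {p : ℝ → ℝ} {δ : ℝ}

theorem log_branchMap (p : ℝ → ℝ) (δ θ : ℝ) :
    1 + δ + 2 * log (branchMap p δ θ) = p (level δ θ) := by
  rw [branchMap, log_exp]; ring

theorem image_branchMap (hp : IsBranch B p) (hδ : 0 < δ) :
    branchMap p δ '' Ioo 0 (π / 2) =
      {v | 0 < v ∧ 1 + δ + 2 * log v ∈ B ∧ potential (1 + δ + 2 * log v) < δ} := by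
  ext v
  constructor
  · rintro ⟨θ, hθ, rfl⟩
    have hL := level_pos hδ (sin_mem_Ioo hθ).1
    rw [mem_ofPred_eq, log_branchMap, hp.potential_eq _ hL]
    exact ⟨exp_pos _, hp.mem _ hL, level_lt hδ hθ⟩
  · rintro ⟨hv, hB, hlt⟩
    set u := 1 + δ + 2 * log v with hu
    have hL := hp.potential_pos u hB
    have hE := exp_sub_one_pos hδ
    have hratio : (exp (potential u) - 1) / (exp δ - 1) ∈ Ioo (0 : ℝ) 1 :=
      ⟨div_pos (exp_sub_one_pos hL) hE, (div_lt_one hE).2 (sub_lt_sub_right (exp_lt_exp.2 hlt) 1)⟩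
    set s := √((exp (potential u) - 1) / (exp δ - 1)) with hs
    have hs0 : 0 < s := Real.sqrt_pos.2 hratio.1
    have hs1 : s < 1 := by rw [hs, Real.sqrt_lt' one_pos]; simpa using hratio.2
    have hsin : sin (arcsin s) = s := sin_arcsin (by linarith) hs1.le
    refine ⟨arcsin s, ⟨arcsin_pos.2 hs0, arcsin_lt_pi_div_two.2 hs1⟩, ?_⟩
    have hlevel : level δ (arcsin s) = potential u := by
      rw [level, hsin, hs, Real.sq_sqrt hratio.1.le, mul_div_cancel₀ _ hE.ne',
        add_sub_cancel, log_exp]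
    rw [branchMap, hlevel, hp.apply_potential hB, hu,
      show (1 + δ + 2 * log v - 1 - δ) / 2 = log v by ring, exp_log hv]

theorem injOn_branchMap (hp : IsBranch B p) (hδ : 0 < δ) :
    InjOn (branchMap p δ) (Ioo 0 (π / 2)) := by
  intro a ha b hb hab
  have hsa := (sin_mem_Ioo ha).1
  have hsb := (sin_mem_Ioo hb).1
  have h1 : p (level δ a) = p (level δ b) := by
    rw [← log_branchMap p δ a, hab, log_branchMap]
  have h2 : level δ a = level δ b := by
    rw [← hp.potential_eq _ (level_pos hδ hsa), h1, hp.potential_eq _ (level_pos hδ hsb)]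
  have h3 := congrArg exp h2
  rw [exp_level hδ, exp_level hδ] at h3
  have h4 : sin a ^ 2 = sin b ^ 2 :=
    mul_left_cancel₀ (exp_sub_one_pos hδ).ne' (add_left_cancel h3)
  exact injOn_sin ⟨by linarith [ha.1, pi_pos], ha.2.le⟩ ⟨by linarith [hb.1, pi_pos], hb.2.le⟩
    ((sq_eq_sq₀ hsa.le hsb.le).1 h4)

theorem hasDerivAt_branchMap (hp : IsBranch B p) (hδ : 0 < δ) {θ : ℝ}
    (hθ : θ ∈ Ioo 0 (π / 2)) :
    HasDerivAt (branchMap p δ) (branchMap p δ θ *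
      (p (level δ θ) / (p (level δ θ) - 1) *
        ((exp δ - 1) * (2 * sin θ * cos θ) / (1 + (exp δ - 1) * sin θ ^ 2)) / 2)) θ :=
  (((((hp.hasDerivAt (level_pos hδ (sin_mem_Ioo hθ).1)).comp θ
    (hasDerivAt_level hδ θ)).sub_const 1).sub_const δ).div_const 2).exp

theorem abs_deriv_branchMap_mul (hp : IsBranch B p) (hδ : 0 < δ) {θ : ℝ}
    (hθ : θ ∈ Ioo 0 (π / 2)) :
    |branchMap p δ θ * (p (level δ θ) / (p (level δ θ) - 1) *
        ((exp δ - 1) * (2 * sin θ * cos θ) / (1 + (exp δ - 1) * sin θ ^ 2)) / 2)| *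
      (1 / √((δ + 1) / 2 - (branchMap p δ θ ^ 2 / 2 - log (branchMap p δ θ)))) =
      √2 * branchWeight p (level δ θ) := by
  have hs := (sin_mem_Ioo hθ).1
  have hc : 0 < cos θ := cos_pos_of_mem_Ioo ⟨by linarith [hθ.1, pi_pos], hθ.2⟩
  have hL := level_pos hδ hs
  have hE := exp_sub_one_pos hδ
  have hmem := hp.mem _ hL
  have hu0 := hp.pos _ hmem
  have hu1 := sub_ne_zero.2 (hp.ne_one hmem)
  have hlevel := exp_level hδ θ
  have hlog := log_branchMap p δ θ
  have hsq : branchMap p δ θ ^ 2 = p (level δ θ) * exp (level δ θ) / exp δ := by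
    have h1 := exp_potential hu0
    rw [hp.potential_eq _ hL] at h1
    rw [h1, mul_div_cancel₀ _ hu0.ne', ← exp_sub, branchMap, ← exp_nat_mul]
    congr 1
    push_cast
    ring
  have hcos : cos θ ^ 2 = 1 - sin θ ^ 2 := by linarith [sin_sq_add_cos_sq θ]
  have harg : (δ + 1) / 2 - (branchMap p δ θ ^ 2 / 2 - log (branchMap p δ θ)) =
      p (level δ θ) * (exp δ - 1) * cos θ ^ 2 / (2 * exp δ) := by
    have : (δ + 1) / 2 - (branchMap p δ θ ^ 2 / 2 - log (branchMap p δ θ)) =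
      (p (level δ θ) - branchMap p δ θ ^ 2) / 2 := by linarith
    rw [this, hsq, hlevel, hcos]
    field_simp
    ring
  rw [harg]
  have hW := branchWeight_nonneg hp hL
  refine (sq_eq_sq₀ (by positivity) (by positivity)).1 ?_
  have hexp1 : 0 ≤ 1 - exp (-level δ θ) :=
    sub_nonneg.2 (Real.exp_le_one_iff.2 (neg_nonpos.2 hL.le))
  simp only [mul_pow, div_pow, sq_abs, branchWeight]
  rw [Real.sq_sqrt (by positivity), Real.sq_sqrt zero_le_two, Real.sq_sqrt hexp1, hsq,
    Real.exp_neg, hlevel]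
  field_simp
  ring

theorem integrableOn_branchWeight (hp : IsBranch B p) (hδ : 0 < δ) :
    IntegrableOn (fun θ => branchWeight p (level δ θ)) (Ioo 0 (π / 2)) := by
  refine IntegrableOn.of_bound measure_Ioo_lt_top (ContinuousOn.aestronglyMeasurable
    (fun θ hθ => ?_) measurableSet_Ioo) 2 ?_
  · have hL := level_pos hδ (sin_mem_Ioo hθ).1
    exact (((continuousOn_branchWeight hp).continuousAt (Ioi_mem_nhds hL)).comp
      (hasDerivAt_level hδ θ).continuousAt).continuousWithinAt
  · filter_upwards [ae_restrict_mem measurableSet_Ioo] with θ hθ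
    have hL := level_pos hδ (sin_mem_Ioo hθ).1
    rw [Real.norm_of_nonneg (branchWeight_nonneg hp hL)]
    exact branchWeight_le_two hp hL

theorem integrableOn_image_branchMap (hp : IsBranch B p) (hδ : 0 < δ) :
    IntegrableOn (fun v => 1 / √((δ + 1) / 2 - (v ^ 2 / 2 - log v)))
      (branchMap p δ '' Ioo 0 (π / 2)) := by
  rw [integrableOn_image_iff_integrableOn_abs_deriv_smul measurableSet_Ioo
    (fun θ hθ => (hasDerivAt_branchMap hp hδ hθ).hasDerivWithinAt) (injOn_branchMap hp hδ)]
  refine IntegrableOn.congr_fun ((integrableOn_branchWeight hp hδ).const_mul √2) (fun θ hθ => ?_)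
    measurableSet_Ioo
  rw [smul_eq_mul, abs_deriv_branchMap_mul hp hδ hθ]

theorem setIntegral_image_branchMap (hp : IsBranch B p) (hδ : 0 < δ) :
    ∫ v in branchMap p δ '' Ioo 0 (π / 2), 1 / √((δ + 1) / 2 - (v ^ 2 / 2 - log v)) =
      √2 * ∫ θ in Ioo 0 (π / 2), branchWeight p (level δ θ) := by
  rw [integral_image_eq_integral_abs_deriv_smul measurableSet_Ioo
    (fun θ hθ => (hasDerivAt_branchMap hp hδ hθ).hasDerivWithinAt) (injOn_branchMap hp hδ),
    ← MeasureTheory.integral_const_mul]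
  refine setIntegral_congr_fun measurableSet_Ioo fun θ hθ => ?_
  simp only [smul_eq_mul]
  rw [abs_deriv_branchMap_mul hp hδ hθ]

end branchMap

section period

variable {p q : ℝ → ℝ} {δ : ℝ}

theorem potential_lt_iff (hp : IsBranch (Ioo 0 1) p) (hq : IsBranch (Ioi 1) q) (hδ : 0 < δ)
    {x : ℝ} (hx : 0 < x) : potential x < δ ↔ p δ < x ∧ x < q δ := by
  obtain ⟨hp0, hp1⟩ := hp.mem δ hδ
  have hq1 : 1 < q δ := hq.mem δ hδ
  rcases le_total x 1 with h | h
  · have := potential_strictAntiOn.lt_iff_gt ⟨hx, h⟩ ⟨hp0, hp1.le⟩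
    rw [hp.potential_eq δ hδ] at this
    rw [this]
    exact ⟨fun hlt => ⟨hlt, h.trans_lt hq1⟩, fun hlt => hlt.1⟩
  · have := potential_strictMonoOn.lt_iff_lt (mem_Ici.2 h) (mem_Ici.2 hq1.le)
    rw [hq.potential_eq δ hδ] at this
    rw [this]
    exact ⟨fun hlt => ⟨hp1.trans_le h, hlt⟩, fun hlt => hlt.2⟩

theorem potential_affine_log_lt_iff {v : ℝ} (hv : 0 < v) (hu : 0 < 1 + δ + 2 * log v) :
    potential (1 + δ + 2 * log v) < δ ↔ v ^ 2 < 1 + δ + 2 * log v := by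
  rw [← log_lt_log_iff (by positivity) hu, log_pow, potential]
  push_cast
  constructor <;> intro <;> linarith

theorem potential_sq_lt_iff {v : ℝ} :
    potential (v ^ 2) < δ ↔ v ^ 2 < 1 + δ + 2 * log v := by
  rw [potential, log_pow]
  push_cast
  constructor <;> intro <;> linarith

theorem branch_lt_exp_neg_lt (hp : IsBranch (Ioo 0 1) p) (hq : IsBranch (Ioi 1) q)
    (hδ : 0 < δ) : p δ < exp (-δ / 2) ^ 2 ∧ exp (-δ / 2) ^ 2 < q δ := by
  rw [← potential_lt_iff hp hq hδ (by positivity), potential_sq_lt_iff, log_exp, ← exp_nat_mul]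
  have : exp ((2 : ℕ) * (-δ / 2)) < 1 := Real.exp_lt_one_iff.2 (by push_cast; linarith)
  linarith

theorem exp_neg_lt_iff {v : ℝ} (hv : 0 < v) :
    exp (-δ / 2) < v ↔ 1 < 1 + δ + 2 * log v := by
  rw [← lt_log_iff_exp_lt hv]
  constructor <;> intro <;> linarith

theorem image_branchMap_upper (hp : IsBranch (Ioo 0 1) p) (hq : IsBranch (Ioi 1) q)
    (hδ : 0 < δ) :
    branchMap q δ '' Ioo 0 (π / 2) = Ioo (exp (-δ / 2)) √(q δ) := by
  rw [image_branchMap hq hδ]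
  ext v
  constructor
  · rintro ⟨hv, hB, hlt⟩
    rw [potential_affine_log_lt_iff hv (one_pos.trans hB), ← potential_sq_lt_iff,
      potential_lt_iff hp hq hδ (by positivity)] at hlt
    exact ⟨(exp_neg_lt_iff hv).2 hB, (Real.lt_sqrt hv.le).2 hlt.2⟩
  · rintro ⟨h1, h2⟩
    have hv : 0 < v := (exp_pos _).trans h1
    have hB := (exp_neg_lt_iff hv).1 h1
    refine ⟨hv, hB, ?_⟩
    rw [potential_affine_log_lt_iff hv (one_pos.trans hB), ← potential_sq_lt_iff,
      potential_lt_iff hp hq hδ (by positivity)]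
    refine ⟨(branch_lt_exp_neg_lt hp hq hδ).1.trans ?_, (Real.lt_sqrt hv.le).1 h2⟩
    gcongr

theorem image_branchMap_lower (hp : IsBranch (Ioo 0 1) p) (hq : IsBranch (Ioi 1) q)
    (hδ : 0 < δ) :
    branchMap p δ '' Ioo 0 (π / 2) = Ioo √(p δ) (exp (-δ / 2)) := by
  rw [image_branchMap hp hδ]
  ext v
  constructor
  · rintro ⟨hv, hB, hlt⟩
    rw [potential_affine_log_lt_iff hv hB.1, ← potential_sq_lt_iff,
      potential_lt_iff hp hq hδ (by positivity)] at hlt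
    refine ⟨(Real.sqrt_lt' hv).2 hlt.1, (log_lt_iff_lt_exp hv).1 ?_⟩
    linarith [hB.2]
  · rintro ⟨h1, h2⟩
    have hv : 0 < v := (Real.sqrt_nonneg _).trans_lt h1
    have hlog := (log_lt_iff_lt_exp hv).2 h2
    have hlt : potential (v ^ 2) < δ := by
      rw [potential_lt_iff hp hq hδ (by positivity)]
      refine ⟨(Real.sqrt_lt' hv).1 h1, lt_trans ?_ (branch_lt_exp_neg_lt hp hq hδ).2⟩
      gcongr
    rw [potential_sq_lt_iff] at hlt
    have hu : 0 < 1 + δ + 2 * log v := lt_trans (by positivity) hlt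
    exact ⟨hv, ⟨hu, by linarith⟩, (potential_affine_log_lt_iff hv hu).2 hlt⟩

/-- The period at level `δ`, as an integral whose integrand is monotone in `δ`. -/
noncomputable def period (p q : ℝ → ℝ) (δ : ℝ) : ℝ :=
  ∫ θ in (0 : ℝ)..π / 2, 2 * (branchWeight p (level δ θ) + branchWeight q (level δ θ))

theorem intervalIntegrable_period_integrand (hp : IsBranch (Ioo 0 1) p)
    (hq : IsBranch (Ioi 1) q) (hδ : 0 < δ) : IntervalIntegrable
      (fun θ => 2 * (branchWeight p (level δ θ) + branchWeight q (level δ θ)))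
      volume 0 (π / 2) := by
  rw [intervalIntegrable_iff_integrableOn_Ioo_of_le (by positivity)]
  exact Integrable.const_mul
    (Integrable.add (integrableOn_branchWeight hp hδ) (integrableOn_branchWeight hq hδ)) 2

theorem sqrt_two_mul_integral_eq_period (hp : IsBranch (Ioo 0 1) p) (hq : IsBranch (Ioi 1) q)
    (hδ : 0 < δ) :
    √2 * ∫ v in √(p δ)..√(q δ), 1 / √((δ + 1) / 2 - (v ^ 2 / 2 - log v)) = period p q δ := by
  obtain ⟨hlow, hup⟩ := branch_lt_exp_neg_lt hp hq hδ
  have hle1 : √(p δ) ≤ exp (-δ / 2) := (Real.sqrt_le_left (exp_pos _).le).2 hlow.le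
  have hle2 : exp (-δ / 2) ≤ √(q δ) := Real.le_sqrt_of_sq_le hup.le
  have hi1 := integrableOn_image_branchMap hp hδ
  have hi2 := integrableOn_image_branchMap hq hδ
  have he1 := setIntegral_image_branchMap hp hδ
  have he2 := setIntegral_image_branchMap hq hδ
  rw [image_branchMap_lower hp hq hδ] at hi1 he1
  rw [image_branchMap_upper hp hq hδ] at hi2 he2
  rw [← intervalIntegral.integral_add_adjacent_intervals
      ((intervalIntegrable_iff_integrableOn_Ioo_of_le hle1).2 hi1)
      ((intervalIntegrable_iff_integrableOn_Ioo_of_le hle2).2 hi2),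
    intervalIntegral.integral_of_le hle1, intervalIntegral.integral_of_le hle2,
    integral_Ioc_eq_integral_Ioo, integral_Ioc_eq_integral_Ioo, he1, he2, ← mul_add, ← mul_assoc,
    Real.mul_self_sqrt zero_le_two, period, intervalIntegral.integral_of_le (by positivity),
    integral_Ioc_eq_integral_Ioo, MeasureTheory.integral_const_mul,
    integral_add (integrableOn_branchWeight hp hδ) (integrableOn_branchWeight hq hδ)]

theorem period_strictAntiOn (hp : IsBranch (Ioo 0 1) p) (hq : IsBranch (Ioi 1) q) :
    StrictAntiOn (period p q) (Ioi 0) := by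
  intro a ha b hb hab
  have hia := intervalIntegrable_period_integrand hp hq ha
  have hib := intervalIntegrable_period_integrand hp hq hb
  rw [← sub_pos, period, period, ← intervalIntegral.integral_sub hia hib]
  refine intervalIntegral.intervalIntegral_pos_of_pos_on (hia.sub hib) (fun θ hθ => ?_)
    (by positivity)
  have hs := (sin_mem_Ioo hθ).1
  have := branchWeight_add_strictAntiOn hp hq (level_pos ha hs) (level_pos hb hs)
    (level_lt_level ha hab hs)
  simp only at this
  linarith

theorem continuousOn_period (hp : IsBranch (Ioo 0 1) p) (hq : IsBranch (Ioi 1) q) :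
    ContinuousOn (period p q) (Ioi 0) := by
  intro δ hδ
  have hsin : ∀ θ ∈ uIoc 0 (π / 2), 0 < sin θ := fun θ hθ => by
    rw [uIoc_of_le (by positivity)] at hθ
    exact sin_pos_of_pos_of_lt_pi hθ.1 (by linarith [hθ.2, pi_pos])
  refine (intervalIntegral.continuousAt_of_dominated_interval (bound := fun _ => 8)
    ?_ ?_ intervalIntegrable_const ?_).continuousWithinAt
  · filter_upwards [Ioi_mem_nhds hδ] with x hx
    exact (intervalIntegrable_period_integrand hp hq hx).aestronglyMeasurable_restrict_uIoc
  · filter_upwards [Ioi_mem_nhds hδ] with x hx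
    refine ae_of_all _ fun θ hθ => ?_
    have hL := level_pos hx (hsin θ hθ)
    have h1 := branchWeight_nonneg hp hL
    have h2 := branchWeight_nonneg hq hL
    rw [Real.norm_of_nonneg (by positivity)]
    linarith [branchWeight_le_two hp hL, branchWeight_le_two hq hL]
  · refine ae_of_all _ fun θ hθ => ?_
    have hL := Ioi_mem_nhds (level_pos hδ (hsin θ hθ))
    have hlevel : ContinuousAt (fun x => level x θ) δ := by
      have := exp_sub_one_pos hδ
      exact ContinuousAt.log (by fun_prop) (by positivity)
    have hcomp : ∀ {B : Set ℝ} {b : ℝ → ℝ}, IsBranch B b →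
        ContinuousAt (fun x => branchWeight b (level x θ)) δ := fun hb =>
      ContinuousAt.comp (f := fun x => level x θ)
        ((continuousOn_branchWeight hb).continuousAt hL) hlevel
    exact ((hcomp hp).add (hcomp hq)).const_mul 2

end period

theorem countable_setOf_rat_of_strictAntiOn {f : ℝ → ℝ} {s : Set ℝ} (hf : StrictAntiOn f s) :
    {x | x ∈ s ∧ ∃ r : ℚ, f x = r}.Countable :=
  MapsTo.countable_of_injOn (t := range ((↑) : ℚ → ℝ)) (fun _ hx => hx.2.imp fun _ => Eq.symm)
    (hf.injOn.mono fun _ hx => hx.1) (countable_range _)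

theorem subset_closure_setOf_rat_of_strictAntiOn {f : ℝ → ℝ} {a : ℝ}
    (hf : StrictAntiOn f (Ioi a)) (hc : ContinuousOn f (Ioi a)) :
    Ioi a ⊆ closure {x | x ∈ Ioi a ∧ ∃ r : ℚ, f x = r} := by
  intro x hx
  refine Metric.mem_closure_iff.2 fun ε hε => ?_
  have hlt : x < x + ε / 2 := by linarith
  have hsub : Icc x (x + ε / 2) ⊆ Ioi a := fun y hy => lt_of_lt_of_le hx hy.1
  obtain ⟨r, hr1, hr2⟩ := exists_rat_btwn (hf hx (hsub ⟨hlt.le, le_rfl⟩) hlt)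
  obtain ⟨y, hy, hfy⟩ := intermediate_value_Icc' hlt.le (hc.mono hsub) ⟨hr1.le, hr2.le⟩
  refine ⟨y, ⟨hsub hy, r, hfy⟩, ?_⟩
  rw [dist_comm, Real.dist_eq, abs_of_nonneg (by linarith [hy.1])]
  linarith [hy.2]

end

/-- with `φ(v) = v²/2 − log v` and, for `c > 1/2`,
`c₁(c) ∈ (0,1)`, `c₂(c) ∈ (1,∞)` the two roots of `φ(v) = c`, the set of
`c ∈ (1/2,∞)` for which `T(c)/(2π)` is rational (where
`T(c) = √2·∫_{c₁(c)}^{c₂(c)} dv/√(c − φ(v))`) is countable and dense in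
`(1/2,∞)`. -/
theorem stmt_14 (c₁ c₂ : ℝ → ℝ)
    (h : ∀ c ∈ Set.Ioi (1/2 : ℝ),
      c₁ c ∈ Set.Ioo (0:ℝ) 1 ∧ c₂ c ∈ Set.Ioi (1:ℝ) ∧
      (c₁ c) ^ 2 / 2 - Real.log (c₁ c) = c ∧ (c₂ c) ^ 2 / 2 - Real.log (c₂ c) = c) :
    Set.Countable {c : ℝ | c ∈ Set.Ioi (1/2 : ℝ) ∧ ∃ r : ℚ,
      (Real.sqrt 2 * ∫ v in (c₁ c)..(c₂ c), 1 / Real.sqrt (c - (v ^ 2 / 2 - Real.log v)))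
        / (2 * π) = (r : ℝ)} ∧
    Set.Ioi (1/2 : ℝ) ⊆
      closure {c : ℝ | c ∈ Set.Ioi (1/2 : ℝ) ∧ ∃ r : ℚ,
        (Real.sqrt 2 * ∫ v in (c₁ c)..(c₂ c), 1 / Real.sqrt (c - (v ^ 2 / 2 - Real.log v)))
          / (2 * π) = (r : ℝ)} := by
  set p : ℝ → ℝ := fun δ => c₁ ((δ + 1) / 2) ^ 2 with hp_def
  set q : ℝ → ℝ := fun δ => c₂ ((δ + 1) / 2) ^ 2 with hq_def
  have hmem : ∀ δ : ℝ, 0 < δ → (δ + 1) / 2 ∈ Set.Ioi (1 / 2 : ℝ) := fun δ hδ => by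
    rw [Set.mem_Ioi]
    linarith
  have hpot : ∀ v c : ℝ, v ^ 2 / 2 - Real.log v = (c + 1) / 2 → potential (v ^ 2) = c :=
    fun v c hv => by
      rw [potential, Real.log_pow]
      push_cast
      linarith
  have hp : IsBranch (Set.Ioo 0 1) p := isBranch_lower fun δ hδ => by
    obtain ⟨⟨h0, h1⟩, -, he, -⟩ := h _ (hmem δ hδ)
    exact ⟨⟨pow_pos h0 2, pow_lt_one₀ h0.le h1 two_ne_zero⟩, hpot _ _ he⟩
  have hq : IsBranch (Set.Ioi 1) q := isBranch_upper fun δ hδ => by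
    obtain ⟨-, h1, -, he⟩ := h _ (hmem δ hδ)
    exact ⟨Set.mem_Ioi.2 (one_lt_pow₀ h1 two_ne_zero), hpot _ _ he⟩
  set T : ℝ → ℝ := fun c => (Real.sqrt 2 * ∫ v in (c₁ c)..(c₂ c),
    1 / Real.sqrt (c - (v ^ 2 / 2 - Real.log v))) / (2 * π)
  have hlevel : ∀ c ∈ Set.Ioi (1 / 2 : ℝ), 2 * c - 1 ∈ Set.Ioi (0 : ℝ) := fun c hc => by
    rw [Set.mem_Ioi] at hc ⊢
    linarith
  have hT : Set.EqOn T (fun c => period p q (2 * c - 1) / (2 * π)) (Set.Ioi (1 / 2)) :=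
    fun c hc => by
      obtain ⟨h1, h2, -, -⟩ := h c hc
      have := sqrt_two_mul_integral_eq_period hp hq (hlevel c hc)
      have hc' : (2 * c - 1 + 1) / 2 = c := by ring
      simp only [hp_def, hq_def, hc', Real.sqrt_sq h1.1.le,
        Real.sqrt_sq (one_pos.trans h2).le] at this
      simp only [T, this, hp_def, hq_def]
  have hanti : StrictAntiOn T (Set.Ioi (1 / 2)) := fun a ha b hb hab => by
    rw [hT ha, hT hb]
    have := period_strictAntiOn hp hq (hlevel a ha) (hlevel b hb) (by linarith)
    have := pi_pos
    simp only
    gcongr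
  have hcont : ContinuousOn T (Set.Ioi (1 / 2)) := ContinuousOn.congr
    (((continuousOn_period hp hq).comp (by fun_prop) hlevel).div_const _) hT
  exact ⟨countable_setOf_rat_of_strictAntiOn hanti,
    subset_closure_setOf_rat_of_strictAntiOn hanti hcont⟩
end
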